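/- arXiv:2210.11659 — 7 statements merged into one kernel-verified Lean document; each statement's English description precedes it below -/
import Mathlib

section
/- Let n ≥ 9 and let r_1, …, r_n be pairwise distinct roots of the E8 lattice such that r_i · r_j ∈ {0, −1} for all i ≠ j. Then there exist integers a_1, …, a_n such that a_1 r_1 + ⋯ + a_n r_n = 0 in ℚ^8 and a_1 + ⋯ + a_n ≠ 0. -/
/-- The standard dot product on `ℚ^8`. -/
def E8dot (v w : Fin 8 → ℚ) : ℚ := ∑ i, v i * w i

/-- Membership in the E8 lattice: all coordinates are integers, or all coordinates
minus `1/2` are integers, and the sum of the coordinates is an even integer. -/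
def InE8 (v : Fin 8 → ℚ) : Prop :=
  ((∀ i, ∃ n : ℤ, v i = n) ∨ (∀ i, ∃ n : ℤ, v i - 1/2 = n)) ∧
    (∃ n : ℤ, ∑ i, v i = 2 * n)

/-- A root of the E8 lattice: a lattice vector of squared length 2. -/
def IsE8Root (r : Fin 8 → ℚ) : Prop := InE8 r ∧ E8dot r r = 2

open Finset in
theorem E8dot_sum_smul {ι : Type*} [Fintype ι] (r : ι → Fin 8 → ℚ) (b c : ι → ℚ) :
    E8dot (∑ i, b i • r i) (∑ j, c j • r j) = ∑ i, ∑ j, b i * c j * E8dot (r i) (r j) := by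
  simp only [E8dot, Finset.sum_apply, Pi.smul_apply, smul_eq_mul, sum_mul, mul_sum]
  conv_rhs => rw [sum_comm]
  rw [sum_comm]
  refine sum_congr rfl fun j _ => ?_
  rw [sum_comm]
  exact sum_congr rfl fun i _ => sum_congr rfl fun k _ => by ring

theorem eq_zero_of_E8dot_self_nonpos {v : Fin 8 → ℚ} (h : E8dot v v ≤ 0) : v = 0 := by
  have hs : ∑ i, v i * v i = 0 := le_antisymm h (Finset.sum_nonneg fun i _ => mul_self_nonneg _)
  rw [Finset.sum_eq_zero_iff_of_nonneg fun i _ => mul_self_nonneg _] at hs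
  ext i
  exact mul_self_eq_zero.mp (hs i (Finset.mem_univ i))

/-- For vectors with pairwise nonpositive dot products, the absolute values of the coefficients
of a linear relation again form a linear relation. -/
theorem sum_abs_smul_eq_zero {ι : Type*} [Fintype ι] {r : ι → Fin 8 → ℚ}
    (hpair : ∀ i j, i ≠ j → E8dot (r i) (r j) ≤ 0) {a : ι → ℚ} (ha : ∑ i, a i • r i = 0) :
    ∑ i, |a i| • r i = 0 := by
  have hsub : ∑ i, (a i)⁺ • r i = ∑ i, (a i)⁻ • r i := by
    rw [← sub_eq_zero, ← Finset.sum_sub_distrib, ← ha]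
    simp only [← sub_smul, posPart_sub_negPart]
  have hpos : ∑ i, (a i)⁺ • r i = 0 := by
    apply eq_zero_of_E8dot_self_nonpos
    nth_rewrite 2 [hsub]
    rw [E8dot_sum_smul]
    refine Finset.sum_nonpos fun i _ => Finset.sum_nonpos fun j _ => ?_
    by_cases hij : i = j
    · subst hij
      rcases le_total 0 (a i) with h | h <;> simp [h]
    · exact mul_nonpos_of_nonneg_of_nonpos
        (mul_nonneg (posPart_nonneg _) (negPart_nonneg _)) (hpair i j hij)
  simp only [← posPart_add_negPart, add_smul, Finset.sum_add_distrib, ← hsub, hpos, add_zero]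

theorem nine_roots_nontrivial_relation (n : ℕ) (hn : 9 ≤ n)
    (r : Fin n → (Fin 8 → ℚ)) (hroot : ∀ i, IsE8Root (r i))
    (hdist : Function.Injective r)
    (hpair : ∀ i j, i ≠ j → E8dot (r i) (r j) = 0 ∨ E8dot (r i) (r j) = -1) :
    ∃ a : Fin n → ℤ, (∑ i, (a i : ℚ) • r i) = 0 ∧ (∑ i, a i) ≠ 0 := by
  have hdep : ¬ LinearIndependent ℤ r := by
    rw [LinearIndependent.iff_fractionRing ℤ ℚ]
    intro h
    have := h.fintype_card_le_finrank
    simp at this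
    omega
  obtain ⟨a, ha, i, hi⟩ := Fintype.not_linearIndependent_iff.mp hdep
  refine ⟨fun i => |a i|, ?_, ?_⟩
  · simp only [Int.cast_abs]
    refine sum_abs_smul_eq_zero (fun i j hij => ?_) ?_
    · rcases hpair i j hij with h | h <;> norm_num [h]
    · simpa only [Int.cast_smul_eq_zsmul] using ha
  · exact (Finset.sum_pos' (fun j _ => abs_nonneg _)
      ⟨i, Finset.mem_univ i, abs_pos.mpr hi⟩).ne'
end

section
/- Let r_1 and r_2 be roots of the E8 lattice with r_1 · r_2 = 0. Then the number of roots s of the E8 lattice such that s · r_1 ∈ {0, −1} and s · r_2 ∈ {0, −1} equals 136. -/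
/-- The signs of the first seven coordinates of a half-integral root. -/
abbrev SevenSigns := ℤˣ × ℤˣ × ℤˣ × ℤˣ × ℤˣ × ℤˣ × ℤˣ

/-- The integral vector `ε e_i + δ e_j`. -/
def integralRoot (p : (Fin 8 × Fin 8) × ℤˣ × ℤˣ) : Fin 8 → ℚ :=
  Pi.single p.1.1 ((p.2.1 : ℤ) : ℚ) + Pi.single p.1.2 ((p.2.2 : ℤ) : ℚ)

/-- The indices of the integral roots `ε e_i + δ e_j`, `i < j`. -/
def integralIndex : Finset ((Fin 8 × Fin 8) × ℤˣ × ℤˣ) :=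
  (Finset.univ.filter fun q : Fin 8 × Fin 8 => q.1 < q.2) ×ˢ Finset.univ

/-- The half-integral root whose first seven signs are given; the last sign is their product. -/
def halfRoot : SevenSigns → Fin 8 → ℚ
  | (a, b, c, d, e, f, g) => fun i =>
    (((![a, b, c, d, e, f, g, a * b * c * d * e * f * g] i : ℤˣ) : ℤ) : ℚ) / 2

/-- The explicit list of the roots of the E8 lattice. -/
def e8Roots : Finset (Fin 8 → ℚ) :=
  integralIndex.image integralRoot ∪ Finset.univ.image halfRoot

theorem E8dot_integralRoot (p : (Fin 8 × Fin 8) × ℤˣ × ℤˣ) (u : Fin 8 → ℚ) :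
    E8dot (integralRoot p) u = (p.2.1 : ℤ) * u p.1.1 + (p.2.2 : ℤ) * u p.1.2 := by
  simp [E8dot, integralRoot, add_mul, Finset.sum_add_distrib, Pi.single_apply]

theorem E8dot_halfRoot (a b c d e f g : ℤˣ) (u : Fin 8 → ℚ) :
    E8dot (halfRoot (a, b, c, d, e, f, g)) u =
      ((a : ℤ) * u 0 + (b : ℤ) * u 1 + (c : ℤ) * u 2 + (d : ℤ) * u 3 + (e : ℤ) * u 4 +
        (f : ℤ) * u 5 + (g : ℤ) * u 6 + (a * b * c * d * e * f * g : ℤ) * u 7) / 2 := by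
  simp [E8dot, halfRoot, Fin.sum_univ_eight]
  ring

theorem sum_integral_pow (u : Fin 8 → ℚ) (n : ℕ) :
    ∑ p ∈ integralIndex, E8dot (integralRoot p) u ^ n =
      ∑ i, ∑ j, if i < j then (u i + u j) ^ n + (u i - u j) ^ n +
        ((-u i + u j) ^ n + (-u i - u j) ^ n) else 0 := by
  rw [integralIndex, Finset.sum_product, Finset.sum_filter, Fintype.sum_prod_type]
  simp [E8dot_integralRoot, UnitsInt.univ, Fintype.sum_prod_type, sub_eq_add_neg]

theorem sum_integral_pow_two (u : Fin 8 → ℚ) :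
    ∑ p ∈ integralIndex, E8dot (integralRoot p) u ^ 2 = 28 * E8dot u u := by
  rw [sum_integral_pow]
  simp only [E8dot, Fin.sum_univ_eight, Fin.reduceLT, if_true, if_false]
  ring

theorem sum_integral_pow_four (u : Fin 8 → ℚ) :
    ∑ p ∈ integralIndex, E8dot (integralRoot p) u ^ 4 =
      12 * E8dot u u ^ 2 + 16 * ∑ i, u i ^ 4 := by
  rw [sum_integral_pow]
  simp only [E8dot, Fin.sum_univ_eight, Fin.reduceLT, if_true, if_false]
  ring

theorem sum_four_signs_pow_two (t x y z v w : ℚ) :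
    ∑ a : ℤˣ, ∑ b : ℤˣ, ∑ c : ℤˣ, ∑ d : ℤˣ,
      (t + (a : ℤ) * x + (b : ℤ) * y + (c : ℤ) * z + (d : ℤ) * v +
        (a * b * c * d : ℤ) * w) ^ 2 =
      16 * (t ^ 2 + w ^ 2 + x ^ 2 + y ^ 2 + z ^ 2 + v ^ 2) := by
  simp [UnitsInt.univ]
  ring

theorem sum_four_signs_pow_four (t x y z v w : ℚ) :
    ∑ a : ℤˣ, ∑ b : ℤˣ, ∑ c : ℤˣ, ∑ d : ℤˣ,
      (t + (a : ℤ) * x + (b : ℤ) * y + (c : ℤ) * z + (d : ℤ) * v +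
        (a * b * c * d : ℤ) * w) ^ 4 =
      48 * (t ^ 2 + w ^ 2 + x ^ 2 + y ^ 2 + z ^ 2 + v ^ 2) ^ 2 -
        32 * (t ^ 4 + w ^ 4 + x ^ 4 + y ^ 4 + z ^ 4 + v ^ 4) := by
  simp [UnitsInt.univ]
  ring

theorem sum_half_pow (u : Fin 8 → ℚ) (n : ℕ) :
    ∑ s, E8dot (halfRoot s) u ^ n = (1 / 2) ^ n * ∑ e : ℤˣ, ∑ f : ℤˣ, ∑ g : ℤˣ,
      ∑ a : ℤˣ, ∑ b : ℤˣ, ∑ c : ℤˣ, ∑ d : ℤˣ,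
      (((e : ℤ) * u 0 + (f : ℤ) * u 1 + (g : ℤ) * u 2) + (a : ℤ) * u 3 + (b : ℤ) * u 4 +
        (c : ℤ) * u 5 + (d : ℤ) * u 6 + (a * b * c * d : ℤ) * ((e * f * g : ℤ) * u 7)) ^ n := by
  simp only [Fintype.sum_prod_type, Finset.mul_sum, E8dot_halfRoot, ← mul_pow]
  refine Fintype.sum_congr _ _ fun e => Fintype.sum_congr _ _ fun f =>
    Fintype.sum_congr _ _ fun g => Fintype.sum_congr _ _ fun a => Fintype.sum_congr _ _ fun b =>
    Fintype.sum_congr _ _ fun c => Fintype.sum_congr _ _ fun d => ?_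
  congr 1
  push_cast
  ring

theorem sum_half_pow_two (u : Fin 8 → ℚ) :
    ∑ e, E8dot (halfRoot e) u ^ 2 = 32 * E8dot u u := by
  rw [sum_half_pow]
  simp only [sum_four_signs_pow_two]
  simp [UnitsInt.univ, Fin.sum_univ_eight, E8dot]
  ring

theorem sum_half_pow_four (u : Fin 8 → ℚ) :
    ∑ e, E8dot (halfRoot e) u ^ 4 = 24 * E8dot u u ^ 2 - 16 * ∑ i, u i ^ 4 := by
  rw [sum_half_pow]
  simp only [sum_four_signs_pow_four]
  simp [UnitsInt.univ, Fin.sum_univ_eight, E8dot]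
  ring

theorem E8dot_comm (u v : Fin 8 → ℚ) : E8dot u v = E8dot v u := by
  simp [E8dot, mul_comm]

theorem E8dot_add_right (s u v : Fin 8 → ℚ) : E8dot s (u + v) = E8dot s u + E8dot s v := by
  simp [E8dot, mul_add, Finset.sum_add_distrib]

theorem E8dot_sub_right (s u v : Fin 8 → ℚ) : E8dot s (u - v) = E8dot s u - E8dot s v := by
  simp [E8dot, mul_sub, Finset.sum_sub_distrib]

theorem E8dot_neg_left (s u : Fin 8 → ℚ) : E8dot (-s) u = -E8dot s u := by
  simp [E8dot]

theorem E8dot_self_nonneg (u : Fin 8 → ℚ) : 0 ≤ E8dot u u :=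
  Finset.sum_nonneg fun i _ => mul_self_nonneg (u i)

theorem eq_zero_of_E8dot_self_eq_zero {u : Fin 8 → ℚ} (h : E8dot u u = 0) : u = 0 := by
  rw [E8dot, Finset.sum_eq_zero_iff_of_nonneg fun i _ => mul_self_nonneg (u i)] at h
  ext i
  simpa using h i (Finset.mem_univ i)

theorem InE8.neg {v : Fin 8 → ℚ} (h : InE8 v) : InE8 (-v) := by
  obtain ⟨h | h, m, hm⟩ := h
  · refine ⟨Or.inl fun i => ?_, -m, by simp [hm]⟩
    obtain ⟨n, hn⟩ := h i
    exact ⟨-n, by simp [hn]⟩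
  · refine ⟨Or.inr fun i => ?_, -m, by simp [hm]⟩
    obtain ⟨n, hn⟩ := h i
    refine ⟨-n - 1, ?_⟩
    push_cast
    rw [← hn, Pi.neg_apply]
    ring

theorem IsE8Root.neg {v : Fin 8 → ℚ} (h : IsE8Root v) : IsE8Root (-v) :=
  ⟨h.1.neg, by simpa [E8dot] using h.2⟩

/-- The E8 lattice is integral. -/
theorem InE8.exists_E8dot_eq_intCast {v w : Fin 8 → ℚ} (hv : InE8 v) (hw : InE8 w) :
    ∃ k : ℤ, E8dot v w = k := by
  have integral_half {v w : Fin 8 → ℚ} (hv : ∀ i, ∃ n : ℤ, v i = n)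
      (hsum : ∃ n : ℤ, ∑ i, v i = 2 * n) (hw : ∀ i, ∃ n : ℤ, w i - 1 / 2 = n) :
      ∃ k : ℤ, E8dot v w = k := by
    choose a ha using hv
    choose b hb using hw
    obtain ⟨m, hm⟩ := hsum
    refine ⟨m + ∑ i, a i * b i, ?_⟩
    have : E8dot v w = (∑ i, v i) / 2 + ∑ i, v i * (w i - 1 / 2) := by
      simp only [E8dot, Finset.sum_div, ← Finset.sum_add_distrib]
      exact Finset.sum_congr rfl fun i _ => by ring
    rw [this, hm]
    simp [ha, ← hb]
  obtain ⟨hv | hv, hsv⟩ := hv <;> obtain ⟨hw | hw, hsw⟩ := hw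
  · choose a ha using hv
    choose b hb using hw
    exact ⟨∑ i, a i * b i, by simp [E8dot, ha, hb]⟩
  · exact integral_half hv hsv hw
  · rw [E8dot_comm]
    exact integral_half hw hsw hv
  · choose a ha using hv
    choose b hb using hw
    obtain ⟨m, hm⟩ := hsv
    obtain ⟨n, hn⟩ := hsw
    refine ⟨m + n - 2 + ∑ i, a i * b i, ?_⟩
    have : E8dot v w = (∑ i, v i) / 2 + (∑ i, w i) / 2 - 2 +
        ∑ i, (v i - 1 / 2) * (w i - 1 / 2) := by
      simp only [E8dot, Fin.sum_univ_eight]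
      ring
    rw [this, hm, hn]
    simp only [ha, hb]
    push_cast
    ring

/-- The inner product of two roots is `0`, `1` or `-1`, unless the roots are proportional. -/
theorem IsE8Root.E8dot_cases {s r : Fin 8 → ℚ} (hs : IsE8Root s) (hr : IsE8Root r) :
    s = r ∨ s = -r ∨ E8dot s r = 0 ∨ E8dot s r = 1 ∨ E8dot s r = -1 := by
  obtain ⟨k, hk⟩ := hs.1.exists_E8dot_eq_intCast hr.1
  have hsub : E8dot (s - r) (s - r) = 4 - 2 * k := by
    have : E8dot (s - r) (s - r) = E8dot s s - 2 * E8dot s r + E8dot r r := by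
      simp only [E8dot, Fin.sum_univ_eight, Pi.sub_apply]
      ring
    rw [this, hs.2, hr.2, hk]
    ring
  have hadd : E8dot (s + r) (s + r) = 4 + 2 * k := by
    have : E8dot (s + r) (s + r) = E8dot s s + 2 * E8dot s r + E8dot r r := by
      simp only [E8dot, Fin.sum_univ_eight, Pi.add_apply]
      ring
    rw [this, hs.2, hr.2, hk]
    ring
  have hle : k ≤ 2 := by
    have := E8dot_self_nonneg (s - r)
    rw [hsub] at this
    exact_mod_cast (by linarith : (k : ℚ) ≤ 2)
  have hge : -2 ≤ k := by
    have := E8dot_self_nonneg (s + r)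
    rw [hadd] at this
    exact_mod_cast (by linarith : (-2 : ℚ) ≤ k)
  rw [hk]
  interval_cases k
  · right; left
    exact eq_neg_of_add_eq_zero_left (eq_zero_of_E8dot_self_eq_zero (by rw [hadd]; norm_num))
  · simp
  · simp
  · simp
  · left
    exact sub_eq_zero.1 (eq_zero_of_E8dot_self_eq_zero (by rw [hsub]; norm_num))

theorem exists_sq_eq_one_and_sum_erase {ι : Type*} [DecidableEq ι] (s : Finset ι) (n : ι → ℤ)
    (m : ℤ) (hpos : 0 < m) (hle : m ≤ 2) (h : ∑ i ∈ s, n i ^ 2 = m) :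
    ∃ i ∈ s, n i ^ 2 = 1 ∧ ∑ k ∈ s.erase i, n k ^ 2 = m - 1 := by
  obtain ⟨i, hi, hne⟩ := Finset.exists_ne_zero_of_sum_ne_zero (h.trans_ne hpos.ne')
  have hsum := Finset.add_sum_erase s (fun k => n k ^ 2) hi
  have hnonneg : 0 ≤ ∑ k ∈ s.erase i, n k ^ 2 := Finset.sum_nonneg fun k _ => sq_nonneg (n k)
  have hsq : n i ^ 2 = 1 := by
    have h0 : n i ≠ 0 := by simpa using hne
    have h1 : n i < 2 := by nlinarith
    have h2 : -2 < n i := by nlinarith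
    generalize n i = a at *
    interval_cases a <;> simp_all
  exact ⟨i, hi, hsq, by linarith⟩

theorem exists_eq_single_add_single (n : Fin 8 → ℤ) (h : ∑ i, n i ^ 2 = 2) :
    ∃ (i j : Fin 8) (x y : ℤˣ), i < j ∧
      n = Pi.single i (x : ℤ) + Pi.single j (y : ℤ) := by
  obtain ⟨i, -, hi, hs⟩ := exists_sq_eq_one_and_sum_erase _ n 2 (by norm_num) le_rfl h
  obtain ⟨j, hj, hj', hs'⟩ := exists_sq_eq_one_and_sum_erase _ n _ (by norm_num) (by norm_num) hs
  have hji : j ≠ i := Finset.ne_of_mem_erase hj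
  obtain ⟨x, hx⟩ := Int.isUnit_iff.2 (sq_eq_one_iff.1 hi)
  obtain ⟨y, hy⟩ := Int.isUnit_iff.2 (sq_eq_one_iff.1 hj')
  have hn : n = Pi.single i (x : ℤ) + Pi.single j (y : ℤ) := by
    ext k
    by_cases hki : k = i
    · subst hki
      simp [hx, hji.symm]
    by_cases hkj : k = j
    · subst hkj
      simp [hy, hji]
    have : n k ^ 2 = 0 :=
      (Finset.sum_eq_zero_iff_of_nonneg fun k _ => sq_nonneg (n k)).1 (by simpa using hs') k
        (by simp [hki, hkj])
    simpa [hki, hkj] using this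
  rcases hji.lt_or_gt with hlt | hlt
  · exact ⟨j, i, y, x, hlt, by rw [hn, add_comm]⟩
  · exact ⟨i, j, x, y, hlt, hn⟩

theorem four_dvd_sum_signs_iff : ∀ a b c d e f g h : ℤˣ,
    (4 : ℤ) ∣ a + b + c + d + e + f + g + h ↔ h = a * b * c * d * e * f * g := by
  decide +kernel

theorem isE8Root_integralRoot {p : (Fin 8 × Fin 8) × ℤˣ × ℤˣ} (hp : p ∈ integralIndex) :
    IsE8Root (integralRoot p) := by
  obtain ⟨⟨i, j⟩, x, y⟩ := p
  have hij : i < j := by simpa [integralIndex] using hp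
  refine ⟨⟨Or.inl fun k => ⟨(Pi.single i (x : ℤ) + Pi.single j (y : ℤ) : Fin 8 → ℤ) k, ?_⟩, ?_⟩, ?_⟩
  · simp only [integralRoot, Pi.add_apply, Pi.single_apply]
    push_cast
    rfl
  · have : ∑ k, integralRoot ((i, j), x, y) k = ((x : ℤ) : ℚ) + ((y : ℤ) : ℚ) := by
      simp [integralRoot, Finset.sum_add_distrib]
    rw [this]
    rcases Int.units_eq_one_or x with rfl | rfl <;> rcases Int.units_eq_one_or y with rfl | rfl
    exacts [⟨1, by norm_num⟩, ⟨0, by norm_num⟩, ⟨0, by norm_num⟩, ⟨-1, by norm_num⟩]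
  · rw [E8dot_integralRoot]
    rcases Int.units_eq_one_or x with rfl | rfl <;> rcases Int.units_eq_one_or y with rfl | rfl <;>
      simp [integralRoot, hij.ne, hij.ne'] <;> norm_num

theorem isE8Root_halfRoot (s : SevenSigns) : IsE8Root (halfRoot s) := by
  obtain ⟨a, b, c, d, e, f, g⟩ := s
  refine ⟨⟨Or.inr fun k => ?_, ?_⟩, ?_⟩
  · simp only [halfRoot]
    rcases Int.units_eq_one_or (![a, b, c, d, e, f, g, a * b * c * d * e * f * g] k) with h | h <;>
      rw [h]
    exacts [⟨0, by norm_num⟩, ⟨-1, by norm_num⟩]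
  · obtain ⟨m, hm⟩ := (four_dvd_sum_signs_iff a b c d e f g _).2 rfl
    refine ⟨m, ?_⟩
    have := congrArg (Int.cast : ℤ → ℚ) hm
    push_cast at this
    simp [halfRoot, Fin.sum_univ_eight]
    linarith
  · have h (x : ℤˣ) : ((x : ℤ) : ℚ) / 2 * (((x : ℤ) : ℚ) / 2) = 1 / 4 := by
      rcases Int.units_eq_one_or x with rfl | rfl <;> norm_num
    simp only [E8dot, halfRoot, h]
    norm_num

theorem exists_halfRoot_eq {v : Fin 8 → ℚ} (hv : ∀ i, ∃ n : ℤ, v i - 1 / 2 = n)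
    (hsum : ∃ n : ℤ, ∑ i, v i = 2 * n) (hsq : E8dot v v = 2) : ∃ s, halfRoot s = v := by
  have hge (i : Fin 8) : 1 / 4 ≤ v i * v i := by
    obtain ⟨n, hn⟩ := hv i
    have : (0 : ℚ) ≤ n * (n + 1) := by
      have : 0 ≤ n * (n + 1) := by rcases le_or_gt 0 n with h | h <;> nlinarith
      exact_mod_cast this
    rw [← hn] at this
    nlinarith
  have heq (i : Fin 8) : v i * v i = 1 / 4 := by
    refine ((Finset.sum_eq_sum_iff_of_le fun i _ => hge i).1 ?_ i (Finset.mem_univ i)).symm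
    rw [E8dot] at hsq
    rw [hsq]
    norm_num
  have hsign (i : Fin 8) : ∃ x : ℤˣ, v i = ((x : ℤ) : ℚ) / 2 := by
    have : (v i - 1 / 2) * (v i + 1 / 2) = 0 := by linarith [heq i]
    rcases mul_eq_zero.1 this with h | h
    · exact ⟨1, by push_cast; linarith⟩
    · exact ⟨-1, by push_cast; linarith⟩
  choose x hx using hsign
  obtain ⟨m, hm⟩ := hsum
  have hprod : x 7 = x 0 * x 1 * x 2 * x 3 * x 4 * x 5 * x 6 := by
    refine (four_dvd_sum_signs_iff ..).1 ⟨m, ?_⟩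
    simp only [Fin.sum_univ_eight, hx] at hm
    have : ((x 0 : ℤ) : ℚ) + (x 1 : ℤ) + (x 2 : ℤ) + (x 3 : ℤ) + (x 4 : ℤ) + (x 5 : ℤ) +
      (x 6 : ℤ) + (x 7 : ℤ) = 4 * m := by linarith
    exact_mod_cast this
  refine ⟨(x 0, x 1, x 2, x 3, x 4, x 5, x 6), ?_⟩
  ext i
  rw [hx, halfRoot, ← hprod]
  fin_cases i <;> rfl

theorem mem_e8Roots {v : Fin 8 → ℚ} : v ∈ e8Roots ↔ IsE8Root v := by
  simp only [e8Roots, Finset.mem_union, Finset.mem_image, Finset.mem_univ, true_and]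
  constructor
  · rintro (⟨p, hp, rfl⟩ | ⟨s, rfl⟩)
    · exact isE8Root_integralRoot hp
    · exact isE8Root_halfRoot s
  · rintro ⟨⟨hv | hv, hsum⟩, hsq⟩
    · left
      choose n hn using hv
      obtain ⟨i, j, x, y, hij, h⟩ := exists_eq_single_add_single n (by
        simp only [E8dot, hn, ← pow_two] at hsq
        exact_mod_cast hsq)
      refine ⟨((i, j), x, y), by simpa [integralIndex] using hij, ?_⟩
      ext k
      rw [hn, h]
      simp only [integralRoot, Pi.add_apply, Pi.single_apply]
      push_cast
      rfl
    · exact Or.inr (exists_halfRoot_eq hv hsum hsq)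

theorem integralRoot_apply_ne_zero_iff {i j : Fin 8} (hij : i < j) (x y : ℤˣ) (k : Fin 8) :
    integralRoot ((i, j), x, y) k ≠ 0 ↔ k = i ∨ k = j := by
  by_cases hi : k = i
  · subst hi
    simp [integralRoot, hij.ne]
  by_cases hj : k = j
  · subst hj
    simp [integralRoot, hij.ne']
  simp [integralRoot, hi, hj]

theorem integralRoot_injOn : Set.InjOn integralRoot integralIndex := by
  rintro ⟨⟨i, j⟩, x, y⟩ hp ⟨⟨i', j'⟩, x', y'⟩ hp' h
  have hij : i < j := by simpa [integralIndex] using hp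
  have hij' : i' < j' := by simpa [integralIndex] using hp'
  have hsupp (k : Fin 8) : k = i ∨ k = j ↔ k = i' ∨ k = j' := by
    rw [← integralRoot_apply_ne_zero_iff hij x y, h, integralRoot_apply_ne_zero_iff hij']
  obtain ⟨rfl, rfl⟩ : i = i' ∧ j = j' := by
    have h1 := hsupp i
    have h2 := hsupp j
    have h3 := hsupp i'
    have h4 := hsupp j'
    grind
  have hx := congrFun h i
  have hy := congrFun h j
  simp [integralRoot, hij.ne, hij.ne'] at hx hy
  simp [Units.ext_iff, hx, hy]

theorem halfRoot_injective : Function.Injective halfRoot := by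
  rintro ⟨a, b, c, d, e, f, g⟩ ⟨a', b', c', d', e', f', g'⟩ h
  have h' (i : Fin 8) := congrFun h i
  simp only [halfRoot, div_left_inj' (two_ne_zero : (2 : ℚ) ≠ 0), Int.cast_inj, Units.val_inj] at h'
  obtain rfl : a = a' := h' 0
  obtain rfl : b = b' := h' 1
  obtain rfl : c = c' := h' 2
  obtain rfl : d = d' := h' 3
  obtain rfl : e = e' := h' 4
  obtain rfl : f = f' := h' 5
  obtain rfl : g = g' := h' 6
  rfl

theorem disjoint_image_integralRoot_image_halfRoot :
    Disjoint (integralIndex.image integralRoot) (Finset.univ.image halfRoot) := by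
  rw [Finset.disjoint_left]
  simp only [Finset.mem_image, Finset.mem_univ, true_and]
  rintro _ ⟨⟨⟨i, j⟩, x, y⟩, -, rfl⟩ ⟨⟨a, b, c, d, e, f, g⟩, h⟩
  have h0 : ((a : ℤ) : ℚ) / 2 =
      ((Pi.single i (x : ℤ) + Pi.single j (y : ℤ) : Fin 8 → ℤ) 0 : ℤ) := by
    refine (congrFun h 0).trans ?_
    simp only [integralRoot, Pi.add_apply, Pi.single_apply]
    push_cast
    rfl
  generalize (Pi.single i (x : ℤ) + Pi.single j (y : ℤ) : Fin 8 → ℤ) 0 = n at h0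
  have h1 : (a : ℤ) = 2 * n := by
    have : ((a : ℤ) : ℚ) = 2 * n := by linarith
    exact_mod_cast this
  rcases Int.units_eq_one_or a with rfl | rfl <;> simp at h1 <;> omega

theorem sum_e8Roots (g : (Fin 8 → ℚ) → ℚ) :
    ∑ s ∈ e8Roots, g s = ∑ p ∈ integralIndex, g (integralRoot p) + ∑ s, g (halfRoot s) := by
  rw [e8Roots, Finset.sum_union disjoint_image_integralRoot_image_halfRoot,
    Finset.sum_image integralRoot_injOn, Finset.sum_image halfRoot_injective.injOn]

theorem card_e8Roots : e8Roots.card = 240 := by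
  rw [e8Roots, Finset.card_union_of_disjoint disjoint_image_integralRoot_image_halfRoot,
    Finset.card_image_of_injOn integralRoot_injOn, Finset.card_image_of_injective _
    halfRoot_injective, integralIndex, Finset.card_product]
  have : (Finset.univ.filter fun q : Fin 8 × Fin 8 => q.1 < q.2).card = 28 := by decide +kernel
  simp [this]

theorem sum_e8Roots_pow_two (u : Fin 8 → ℚ) :
    ∑ s ∈ e8Roots, E8dot s u ^ 2 = 60 * E8dot u u := by
  rw [sum_e8Roots fun s => E8dot s u ^ 2, sum_integral_pow_two, sum_half_pow_two]
  ring

theorem sum_e8Roots_pow_four (u : Fin 8 → ℚ) :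
    ∑ s ∈ e8Roots, E8dot s u ^ 4 = 36 * E8dot u u ^ 2 := by
  rw [sum_e8Roots fun s => E8dot s u ^ 4, sum_integral_pow_four, sum_half_pow_four]
  ring

theorem sum_e8Roots_neg (g : (Fin 8 → ℚ) → ℚ) : ∑ s ∈ e8Roots, g (-s) = ∑ s ∈ e8Roots, g s :=
  Finset.sum_nbij' Neg.neg Neg.neg (fun _ hs => mem_e8Roots.2 (mem_e8Roots.1 hs).neg)
    (fun _ hs => mem_e8Roots.2 (mem_e8Roots.1 hs).neg) (fun s _ => neg_neg s)
    (fun s _ => neg_neg s) fun _ _ => rfl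

theorem sum_e8Roots_quadratic_mul_quadratic {u v : Fin 8 → ℚ} (hu : E8dot u u = 2)
    (hv : E8dot v v = 2) (huv : E8dot u v = 0) :
    ∑ s ∈ e8Roots, (1 - E8dot s u / 2 - E8dot s u ^ 2 / 2) *
      (1 - E8dot s v / 2 - E8dot s v ^ 2 / 2) = 132 := by
  have hadd : E8dot (u + v) (u + v) = 4 := by
    rw [E8dot_add_right, E8dot_comm _ u, E8dot_comm _ v, E8dot_add_right, E8dot_add_right,
      E8dot_comm v u, hu, hv, huv]
    norm_num
  have hsub : E8dot (u - v) (u - v) = 4 := by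
    rw [E8dot_sub_right, E8dot_comm _ u, E8dot_comm _ v, E8dot_sub_right, E8dot_sub_right,
      E8dot_comm v u, hu, hv, huv]
    norm_num
  set F : (Fin 8 → ℚ) → ℚ := fun s => (1 - E8dot s u / 2 - E8dot s u ^ 2 / 2) *
      (1 - E8dot s v / 2 - E8dot s v ^ 2 / 2) with hF
  have heven (s : Fin 8 → ℚ) : F s + F (-s) = 2 * 1 - E8dot s u ^ 2 - E8dot s v ^ 2 +
      (E8dot s (u + v) ^ 2 - E8dot s (u - v) ^ 2) / 8 +
      (E8dot s (u + v) ^ 4 + E8dot s (u - v) ^ 4 - 2 * E8dot s u ^ 4 - 2 * E8dot s v ^ 4) / 24 := by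
    simp only [hF, E8dot_neg_left, E8dot_add_right, E8dot_sub_right]
    ring
  have htwo : ∑ s ∈ e8Roots, (F s + F (-s)) = 264 := by
    simp only [heven, Finset.sum_add_distrib, Finset.sum_sub_distrib, ← Finset.sum_div,
      ← Finset.mul_sum, sum_e8Roots_pow_two, sum_e8Roots_pow_four, hu, hv, hadd, hsub,
      Finset.sum_const, card_e8Roots]
    norm_num
  rw [Finset.sum_add_distrib, sum_e8Roots_neg] at htwo
  linarith

theorem count_roots_meeting_two_orthogonal_roots
    (r₁ r₂ : Fin 8 → ℚ) (h₁ : IsE8Root r₁) (h₂ : IsE8Root r₂)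
    (horth : E8dot r₁ r₂ = 0) :
    {s : Fin 8 → ℚ | IsE8Root s ∧ (E8dot s r₁ = 0 ∨ E8dot s r₁ = -1) ∧
      (E8dot s r₂ = 0 ∨ E8dot s r₂ = -1)}.ncard = 136 := by
  have horth' : E8dot r₂ r₁ = 0 := by rw [E8dot_comm, horth]
  have hset : {s : Fin 8 → ℚ | IsE8Root s ∧ (E8dot s r₁ = 0 ∨ E8dot s r₁ = -1) ∧
      (E8dot s r₂ = 0 ∨ E8dot s r₂ = -1)} =
      ↑(e8Roots.filter fun s => (E8dot s r₁ = 0 ∨ E8dot s r₁ = -1) ∧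
        (E8dot s r₂ = 0 ∨ E8dot s r₂ = -1)) := by
    ext s
    simp [mem_e8Roots]
  have hne : r₁ ≠ r₂ := by
    rintro rfl
    linarith [h₁.2]
  have hindicator : ∀ s ∈ e8Roots,
      (if (E8dot s r₁ = 0 ∨ E8dot s r₁ = -1) ∧ (E8dot s r₂ = 0 ∨ E8dot s r₂ = -1)
        then (1 : ℚ) else 0) =
      (1 - E8dot s r₁ / 2 - E8dot s r₁ ^ 2 / 2) * (1 - E8dot s r₂ / 2 - E8dot s r₂ ^ 2 / 2) +
        (if s = r₁ then 2 else 0) + (if s = r₂ then 2 else 0) := by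
    intro s hs
    rw [mem_e8Roots] at hs
    by_cases e₁ : s = r₁
    · subst e₁
      norm_num [h₁.2, horth, hne]
    by_cases e₂ : s = r₂
    · subst e₂
      norm_num [h₂.2, horth', hne.symm]
    rw [if_neg e₁, if_neg e₂]
    rcases hs.E8dot_cases h₁ with h | rfl | ha
    · exact absurd h e₁
    · norm_num [E8dot_neg_left, h₁.2, horth]
    rcases hs.E8dot_cases h₂ with h | rfl | hb
    · exact absurd h e₂
    · norm_num [E8dot_neg_left, h₂.2, horth']
    rcases ha with ha | ha | ha <;> rcases hb with hb | hb | hb <;> rw [ha, hb] <;> norm_num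
  rw [hset, Set.ncard_coe_finset]
  have : ((e8Roots.filter fun s => (E8dot s r₁ = 0 ∨ E8dot s r₁ = -1) ∧
      (E8dot s r₂ = 0 ∨ E8dot s r₂ = -1)).card : ℚ) = 136 := by
    rw [Finset.natCast_card_filter, Finset.sum_congr rfl hindicator, Finset.sum_add_distrib,
      Finset.sum_add_distrib, sum_e8Roots_quadratic_mul_quadratic h₁.2 h₂.2 horth,
      Finset.sum_ite_eq', Finset.sum_ite_eq', if_pos (mem_e8Roots.2 h₁),
      if_pos (mem_e8Roots.2 h₂)]
    norm_num
  exact_mod_cast this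
end

section
/- Let r_1 and r_2 be roots of the E8 lattice with r_1 · r_2 = 0. Then the number of 8-element subsets S of the set of roots of the E8 lattice such that r_1 ∈ S, r_2 ∈ S, and r · s ∈ {0, −1} for all distinct r, s ∈ S, equals 8963624. -/
/-- An 8-element set of E8 roots pairwise meeting with dot product 0 or -1. -/
def IsRootClique8 (S : Finset (Fin 8 → ℚ)) : Prop :=
  S.card = 8 ∧ (∀ r ∈ S, IsE8Root r) ∧
    ∀ r ∈ S, ∀ s ∈ S, r ≠ s → (E8dot r s = 0 ∨ E8dot r s = -1)

namespace RootClique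

open Finset

section CliquesIn

variable {V : Type*} {G : SimpleGraph V} {k : ℕ} {P : Finset V}

open scoped Classical in
/-- The `k`-element cliques of `G` all of whose vertices lie in `P`. -/
noncomputable def cliquesIn (G : SimpleGraph V) (k : ℕ) (P : Finset V) : Finset (Finset V) :=
  {T ∈ P.powersetCard k | G.IsClique T}

theorem mem_cliquesIn {T : Finset V} :
    T ∈ cliquesIn G k P ↔ T ⊆ P ∧ T.card = k ∧ G.IsClique T := by
  simp [cliquesIn, Finset.mem_powersetCard, and_assoc]

theorem card_cliquesIn_zero : (cliquesIn G 0 P).card = 1 := by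
  rw [Finset.card_eq_one]
  refine ⟨∅, ?_⟩
  ext T
  simp only [mem_cliquesIn, Finset.card_eq_zero, Finset.mem_singleton]
  constructor
  · exact fun h => h.2.1
  · rintro rfl
    simp

open scoped Classical in
theorem card_cliquesIn_filter_mem (q : Finset V → Prop) {x : V} (hx : x ∈ P) :
    #{T ∈ cliquesIn G (k + 1) P | x ∈ T ∧ q (T.erase x)} =
      #{T ∈ cliquesIn G k {y ∈ P | G.Adj x y} | q T} := by
  refine Finset.card_nbij' (fun T => T.erase x) (fun T => insert x T) ?_ ?_ ?_ ?_
  · intro T hT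
    simp only [Finset.coe_filter, mem_cliquesIn, Set.mem_ofPred_eq] at hT ⊢
    obtain ⟨⟨hTP, hcard, hT⟩, hxT, hq⟩ := hT
    refine ⟨⟨fun y hy => ?_, ?_, ?_⟩, hq⟩
    · rw [Finset.mem_erase] at hy
      exact Finset.mem_filter.2 ⟨hTP hy.2, hT hxT hy.2 hy.1.symm⟩
    · rw [Finset.card_erase_of_mem hxT, hcard, Nat.add_sub_cancel]
    · exact hT.subset (by simp)
  · intro T hT
    simp only [Finset.coe_filter, mem_cliquesIn, Set.mem_ofPred_eq] at hT ⊢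
    obtain ⟨⟨hTP, hcard, hT⟩, hq⟩ := hT
    have hxT : x ∉ T := fun h => G.irrefl (Finset.mem_filter.1 (hTP h)).2
    refine ⟨⟨?_, ?_, ?_⟩, Finset.mem_insert_self _ _, ?_⟩
    · exact Finset.insert_subset hx (hTP.trans (Finset.filter_subset _ _))
    · rw [Finset.card_insert_of_notMem hxT, hcard]
    · rw [Finset.coe_insert, SimpleGraph.isClique_insert]
      exact ⟨hT, fun y hy _ => (Finset.mem_filter.1 (hTP hy)).2⟩
    · rwa [Finset.erase_insert hxT]
  · intro T hT
    simp only [Finset.coe_filter, Set.mem_ofPred_eq] at hT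
    exact Finset.insert_erase hT.2.1
  · intro T hT
    simp only [Finset.coe_filter, mem_cliquesIn, Set.mem_ofPred_eq] at hT
    exact Finset.erase_insert fun h => G.irrefl (Finset.mem_filter.1 (hT.1.1 h)).2

open scoped Classical in
theorem succ_mul_card_cliquesIn :
    (k + 1) * (cliquesIn G (k + 1) P).card =
      ∑ x ∈ P, (cliquesIn G k {y ∈ P | G.Adj x y}).card := by
  calc (k + 1) * (cliquesIn G (k + 1) P).card
      = ∑ T ∈ cliquesIn G (k + 1) P, #{x ∈ P | x ∈ T} := by
        rw [Finset.sum_congr rfl (g := fun _ => k + 1), Finset.sum_const, smul_eq_mul, mul_comm]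
        intro T hT
        rw [mem_cliquesIn] at hT
        rw [Finset.filter_mem_eq_inter, Finset.inter_eq_right.2 hT.1, hT.2.1]
    _ = ∑ x ∈ P, #{T ∈ cliquesIn G (k + 1) P | x ∈ T} :=
        Finset.sum_card_bipartiteAbove_eq_sum_card_bipartiteBelow (fun T x => x ∈ T)
    _ = _ := Finset.sum_congr rfl fun x hx => by
        simpa using card_cliquesIn_filter_mem (k := k) (G := G) (fun _ => True) hx

open scoped Classical in
theorem card_cliquesIn_insert {v : V} (hv : v ∉ P) :
    (cliquesIn G (k + 1) (insert v P)).card =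
      (cliquesIn G (k + 1) P).card + (cliquesIn G k {y ∈ P | G.Adj v y}).card := by
  rw [← Finset.card_filter_add_card_filter_not (s := cliquesIn G (k + 1) (insert v P))
    (fun T => v ∈ T), add_comm]
  congr 1
  · congr 1
    ext T
    simp only [Finset.mem_filter, mem_cliquesIn]
    constructor
    · rintro ⟨⟨h, h'⟩, hvT⟩
      exact ⟨(Finset.subset_insert_iff_of_notMem hvT).1 h, h'⟩
    · rintro ⟨h, h'⟩
      exact ⟨⟨h.trans (Finset.subset_insert _ _), h'⟩, fun hvT => hv (h hvT)⟩
  · have := card_cliquesIn_filter_mem (k := k) (G := G) (fun _ => True)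
      (Finset.mem_insert_self v P)
    simp only [and_true, Finset.filter_true] at this
    rw [this, Finset.filter_insert, if_neg G.irrefl]

theorem card_cliquesIn_map (e : G ≃g G) :
    (cliquesIn G k (P.map e.toEquiv.toEmbedding)).card = (cliquesIn G k P).card := by
  have hle : ∀ (e : G ≃g G) (P : Finset V),
      (cliquesIn G k P).card ≤ (cliquesIn G k (P.map e.toEquiv.toEmbedding)).card := by
    intro e P
    refine Finset.card_le_card_of_injOn (fun T => T.map e.toEquiv.toEmbedding) ?_
      (Finset.map_injective _).injOn
    intro T hT
    rw [Finset.mem_coe, mem_cliquesIn] at hT ⊢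
    refine ⟨Finset.map_subset_map.2 hT.1, by rw [Finset.card_map, hT.2.1], ?_⟩
    intro x hx y hy hxy
    simp only [Finset.coe_map, Set.mem_image, Finset.mem_coe] at hx hy
    obtain ⟨x, hx, rfl⟩ := hx
    obtain ⟨y, hy, rfl⟩ := hy
    exact e.map_adj_iff.2 (hT.2.2 hx hy fun h => hxy (by rw [h]))
  refine le_antisymm ?_ (hle e P)
  refine (hle e.symm _).trans_eq ?_
  congr 2
  ext x
  simp only [Finset.mem_map_equiv]
  change e.symm (e x) ∈ P ↔ x ∈ P
  rw [RelIso.symm_apply_apply]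

/-- The number of `k`-element cliques of the relation `adj` supported on a list of vertices,
computed by splitting off the first vertex. -/
def cliqueCount {α : Type*} (adj : α → α → Bool) : ℕ → List α → ℕ
  | 0, _ => 1
  | _ + 1, [] => 0
  | k + 1, v :: L => cliqueCount adj (k + 1) L + cliqueCount adj k (L.filter (adj v))
termination_by k L => (k, L.length)

open scoped Classical in
theorem card_cliquesIn_toFinset {α : Type*} (adj : α → α → Bool) (f : α → V) (k : ℕ) (L : List α)
    (hL : (L.map f).Nodup) (hadj : ∀ a ∈ L, ∀ b ∈ L, adj a b = true ↔ G.Adj (f a) (f b)) :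
    (cliquesIn G k (L.map f).toFinset).card = cliqueCount adj k L := by
  induction k generalizing L with
  | zero => rw [card_cliquesIn_zero, cliqueCount]
  | succ k ihk =>
  induction L with
  | nil =>
    rw [cliqueCount, Finset.card_eq_zero, Finset.eq_empty_iff_forall_notMem]
    intro T hT
    obtain ⟨hT, hcard, -⟩ := mem_cliquesIn.1 hT
    rw [List.map_nil, List.toFinset_nil, Finset.subset_empty] at hT
    rw [hT, Finset.card_empty] at hcard
    omega
  | cons v L ihL =>
    rw [List.map_cons, List.nodup_cons] at hL
    simp only [List.mem_cons] at hadj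
    rw [cliqueCount, List.map_cons, List.toFinset_cons, card_cliquesIn_insert (by simpa using hL.1),
      ihL hL.2 (fun a ha b hb => hadj a (.inr ha) b (.inr hb)), ← ihk _
        (hL.2.sublist (List.filter_sublist.map f))
        (fun a ha b hb => hadj a (.inr (List.mem_filter.1 ha).1) b (.inr (List.mem_filter.1 hb).1))]
    congr 3
    ext y
    simp only [Finset.mem_filter, List.mem_toFinset, List.mem_map, List.mem_filter]
    constructor
    · rintro ⟨⟨a, ha, rfl⟩, h⟩
      exact ⟨a, ⟨ha, (hadj v (.inl rfl) a (.inr ha)).2 h⟩, rfl⟩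
    · rintro ⟨a, ⟨ha, h⟩, rfl⟩
      exact ⟨⟨a, ha, rfl⟩, (hadj v (.inl rfl) a (.inr ha)).1 h⟩

end CliquesIn

section Codes

/-- The vector encoded by a list of digits; the digit `d` stands for the coordinate `(d - 2) / 2`.
-/
def vec (l : List ℕ) : Fin 8 → ℚ := fun i => ((l.getD i 0 : ℚ) - 2) / 2

/-- The sum of the digits. -/
def digitSum : List ℕ → ℕ
  | [] => 0
  | a :: l => Nat.add a (digitSum l)

/-- The dot product of two lists of digits. -/
def digitDot : List ℕ → List ℕ → ℕ
  | a :: l, b :: m => Nat.add (Nat.mul a b) (digitDot l m)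
  | _, _ => 0

/-- Decides whether `4 * E8dot (vec a) (vec b) + 8 = c`. -/
def dotIs (c : ℕ) (a b : List ℕ) : Bool :=
  Nat.beq (Nat.add (digitDot a b) 40) (Nat.add (Nat.mul 2 (Nat.add (digitSum a) (digitSum b))) c)

theorem exists_eq_of_length_eq_eight {a : List ℕ} (h : a.length = 8) :
    ∃ a₀ a₁ a₂ a₃ a₄ a₅ a₆ a₇, a = [a₀, a₁, a₂, a₃, a₄, a₅, a₆, a₇] := by
  match a, h with
  | [a₀, a₁, a₂, a₃, a₄, a₅, a₆, a₇], _ => exact ⟨a₀, a₁, a₂, a₃, a₄, a₅, a₆, a₇, rfl⟩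

theorem digitDot_add_forty {a b : List ℕ} (ha : a.length = 8) (hb : b.length = 8) :
    (digitDot a b + 40 : ℚ) =
      2 * (digitSum a + digitSum b) + (4 * E8dot (vec a) (vec b) + 8) := by
  obtain ⟨a₀, a₁, a₂, a₃, a₄, a₅, a₆, a₇, rfl⟩ := exists_eq_of_length_eq_eight ha
  obtain ⟨b₀, b₁, b₂, b₃, b₄, b₅, b₆, b₇, rfl⟩ := exists_eq_of_length_eq_eight hb
  simp only [digitDot, digitSum, Nat.add_eq, Nat.mul_eq, E8dot, Fin.sum_univ_eight, vec]
  simp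
  ring

theorem dotIs_iff {c : ℕ} {a b : List ℕ} (ha : a.length = 8) (hb : b.length = 8) :
    dotIs c a b = true ↔ 4 * E8dot (vec a) (vec b) + 8 = c := by
  have h := digitDot_add_forty ha hb
  simp only [dotIs, Nat.beq_eq, Nat.add_eq, Nat.mul_eq]
  rw [← Nat.cast_inj (R := ℚ)]
  push_cast
  constructor <;> intro h' <;> linarith

/-- Decides whether two coded roots have dot product `0` or `-1`. -/
def adjC (a b : List ℕ) : Bool := dotIs 8 a b || dotIs 4 a b

theorem vec_injOn {a b : List ℕ} (ha : a.length = 8) (hb : b.length = 8) (h : vec a = vec b) :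
    a = b := by
  refine List.ext_getElem (ha.trans hb.symm) fun i h₁ h₂ => ?_
  have := congrFun h ⟨i, ha ▸ h₁⟩
  simp only [vec, List.getD_eq_getElem _ _ h₁, List.getD_eq_getElem _ _ h₂] at this
  have : (a[i] : ℚ) = b[i] := by linarith
  exact_mod_cast this

/-- The square of `d - 2`, in natural numbers. -/
def sqDist (d : ℕ) : ℕ := (d - 2) ^ 2 + (2 - d) ^ 2

/-- All lists of `n` digits from `D` that encode vectors of squared length `s / 4`. -/
def vecs (D : List ℕ) : ℕ → ℕ → List (List ℕ)
  | 0, s => if s = 0 then [[]] else []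
  | n + 1, s => D.flatMap fun d =>
      if sqDist d ≤ s then (vecs D n (s - sqDist d)).map (List.cons d) else []

theorem mem_vecs {D l : List ℕ} (hD : ∀ d ∈ l, d ∈ D) :
    l ∈ vecs D l.length (l.map sqDist).sum := by
  induction l with
  | nil => simp [vecs]
  | cons d l ih =>
    simp only [List.mem_cons, forall_eq_or_imp] at hD
    simp only [List.length_cons, List.map_cons, List.sum_cons, vecs, List.mem_flatMap]
    refine ⟨d, hD.1, ?_⟩
    simpa using ih hD.2

/-- The codes of the roots of the E8 lattice. -/
def codes : List (List ℕ) :=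
  vecs [0, 2, 4] 8 8 ++ (vecs [1, 3] 8 8).filter fun l => Nat.beq (Nat.mod (digitSum l) 4) 0

/-- Decides whether a list of digits encodes a root. -/
def isRootCode (l : List ℕ) : Bool :=
  Nat.beq l.length 8 && (l.all (fun d => Nat.beq (Nat.mod d 2) 0) ||
    l.all fun d => Nat.beq (Nat.mod d 2) 1) && Nat.beq (Nat.mod (digitSum l) 4) 0 && dotIs 16 l l

theorem codes_all_isRootCode : codes.all isRootCode = true := by decide +kernel

theorem length_eq_of_mem_codes {l : List ℕ} (hl : l ∈ codes) : l.length = 8 := by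
  have := List.all_eq_true.1 codes_all_isRootCode l hl
  simp only [isRootCode, Bool.and_eq_true, Nat.beq_eq] at this
  exact this.1.1.1

theorem sum_vec {l : List ℕ} (hl : l.length = 8) : ∑ i, vec l i = (digitSum l - 16) / 2 := by
  obtain ⟨a₀, a₁, a₂, a₃, a₄, a₅, a₆, a₇, rfl⟩ := exists_eq_of_length_eq_eight hl
  simp only [digitSum, Nat.add_eq, Fin.sum_univ_eight, vec]
  simp
  ring

theorem isE8Root_vec {l : List ℕ} (hl : l ∈ codes) : IsE8Root (vec l) := by
  have h8 := length_eq_of_mem_codes hl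
  have h := List.all_eq_true.1 codes_all_isRootCode l hl
  simp only [isRootCode, Bool.and_eq_true, Bool.or_eq_true, Nat.beq_eq, List.all_eq_true] at h
  obtain ⟨⟨⟨-, hpar⟩, hsum⟩, hdot⟩ := h
  rw [dotIs_iff h8 h8] at hdot
  change digitSum l % 4 = 0 at hsum
  refine ⟨⟨hpar.imp (fun h i => ?_) (fun h i => ?_), ?_⟩, by push_cast at hdot; linarith⟩
  · have hi : (i : ℕ) < l.length := by omega
    have : l[i] % 2 = 0 := h _ (List.getElem_mem hi)
    refine ⟨(l[i] / 2 : ℕ) - 1, ?_⟩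
    obtain ⟨e, he⟩ : ∃ e, l[i] = 2 * e := ⟨l[i] / 2, by omega⟩
    simp only [vec, List.getD_eq_getElem _ _ hi]
    simp only [Fin.getElem_fin] at he ⊢
    rw [he, Nat.mul_div_cancel_left _ two_pos]
    push_cast
    ring
  · have hi : (i : ℕ) < l.length := by omega
    have : l[i] % 2 = 1 := h _ (List.getElem_mem hi)
    refine ⟨(l[i] / 2 : ℕ) - 1, ?_⟩
    obtain ⟨e, he⟩ : ∃ e, l[i] = 2 * e + 1 := ⟨l[i] / 2, by omega⟩
    simp only [vec, List.getD_eq_getElem _ _ hi]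
    simp only [Fin.getElem_fin] at he ⊢
    rw [he, show (2 * e + 1) / 2 = e by omega]
    push_cast
    ring
  · obtain ⟨e, he⟩ : ∃ e, digitSum l = 4 * e := ⟨digitSum l / 4, by omega⟩
    refine ⟨e - 4, ?_⟩
    rw [sum_vec h8, he]
    push_cast
    ring

theorem exists_code {v : Fin 8 → ℚ} {m : Fin 8 → ℤ} (hv : ∀ i, v i = m i / 2)
    (hdot : E8dot v v = 2) {D : List ℕ} (hD : ∀ i, -2 ≤ m i → m i ≤ 2 → (m i + 2).toNat ∈ D) :
    ∃ l ∈ vecs D 8 8, l.length = 8 ∧ vec l = v := by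
  have hsum : ∑ i, m i ^ 2 = 8 := by
    have : (∑ i, (m i : ℚ) ^ 2) = 4 * E8dot v v := by
      rw [E8dot, Finset.mul_sum]
      exact Finset.sum_congr rfl fun i _ => by rw [hv]; ring
    rw [hdot] at this
    have h : ((∑ i, m i ^ 2 : ℤ) : ℚ) = (8 : ℤ) := by push_cast; rw [this]; norm_num
    exact_mod_cast h
  have hle : ∀ i, -2 ≤ m i ∧ m i ≤ 2 := fun i => by
    have := Finset.single_le_sum (f := fun i => m i ^ 2) (fun i _ => sq_nonneg (m i))
      (Finset.mem_univ i)
    simp only [hsum] at this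
    constructor <;> nlinarith
  have hsq : ∀ i, ((sqDist (m i + 2).toNat : ℕ) : ℤ) = m i ^ 2 := fun i => by
    obtain ⟨h₁, h₂⟩ := hle i
    generalize m i = x at h₁ h₂
    interval_cases x <;> rfl
  refine ⟨List.ofFn fun i => (m i + 2).toNat, ?_, by simp, ?_⟩
  · have := mem_vecs (l := List.ofFn fun i => (m i + 2).toNat) (D := D) (fun d hd => by
      obtain ⟨i, rfl⟩ := (List.mem_ofFn' _ _).1 hd
      exact hD i (hle i).1 (hle i).2)
    rw [List.length_ofFn, List.map_ofFn, List.sum_ofFn] at this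
    convert this
    zify
    rw [← hsum]
    exact Finset.sum_congr rfl fun i _ => (hsq i).symm
  · funext i
    have h := (hle i).1
    have : (((m i + 2).toNat : ℤ) : ℚ) = m i + 2 := by
      rw [Int.toNat_of_nonneg (by omega)]; push_cast; rfl
    rw [Int.cast_natCast] at this
    simp only [vec, hv]
    rw [List.getD_eq_getElem _ _ (by simp), List.getElem_ofFn, this]
    ring

theorem exists_code_of_isE8Root {v : Fin 8 → ℚ} (hv : IsE8Root v) : ∃ l ∈ codes, vec l = v := by
  obtain ⟨⟨h, s, hs⟩, hdot⟩ := hv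
  rcases h with h | h
  · choose n hn using h
    obtain ⟨l, hl, -, hlv⟩ := exists_code (m := fun i => 2 * n i) (D := [0, 2, 4])
      (fun i => by rw [hn]; push_cast; ring) hdot (fun i h₁ h₂ => by
        generalize n i = x at h₁ h₂
        have h₃ : -1 ≤ x := by omega
        have h₄ : x ≤ 1 := by omega
        interval_cases x <;> decide)
    exact ⟨l, List.mem_append_left _ hl, hlv⟩
  · choose n hn using h
    obtain ⟨l, hl, h8, hlv⟩ := exists_code (m := fun i => 2 * n i + 1) (D := [1, 3])
      (fun i => by have := hn i; push_cast; linarith) hdot (fun i h₁ h₂ => by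
        generalize n i = x at h₁ h₂
        have h₃ : -1 ≤ x := by omega
        have h₄ : x ≤ 0 := by omega
        interval_cases x <;> decide)
    refine ⟨l, List.mem_append_right _ (List.mem_filter.2 ⟨hl, ?_⟩), hlv⟩
    rw [← hlv, sum_vec h8] at hs
    have : (digitSum l : ℤ) = 4 * s + 16 := by
      have : (digitSum l : ℚ) = 4 * s + 16 := by linarith
      exact_mod_cast this
    rw [Nat.beq_eq]
    change digitSum l % 4 = 0
    omega

end Codes

section Isometries

theorem E8dot_comm (x y : Fin 8 → ℚ) : E8dot x y = E8dot y x := dotProduct_comm x y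

theorem E8dot_sub_left (x y z : Fin 8 → ℚ) : E8dot (x - y) z = E8dot x z - E8dot y z :=
  sub_dotProduct x y z

theorem E8dot_smul_left (c : ℚ) (x y : Fin 8 → ℚ) : E8dot (c • x) y = c * E8dot x y :=
  smul_dotProduct c x y

theorem E8dot_sub_right (x y z : Fin 8 → ℚ) : E8dot x (y - z) = E8dot x y - E8dot x z :=
  dotProduct_sub x y z

theorem E8dot_smul_right (c : ℚ) (x y : Fin 8 → ℚ) : E8dot x (c • y) = c * E8dot x y :=
  dotProduct_smul c x y

theorem inE8_iff {x : Fin 8 → ℚ} :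
    InE8 x ↔ ∃ (n : Fin 8 → ℤ) (h s : ℤ), (∀ i, x i = n i + h / 2) ∧ ∑ i, n i = 2 * s := by
  constructor
  · rintro ⟨h | h, s, hs⟩
    · choose n hn using h
      refine ⟨n, 0, s, fun i => by rw [hn]; simp, ?_⟩
      simp only [hn] at hs
      exact_mod_cast hs
    · choose n hn using h
      have hx : ∀ i, x i = n i + 1 / 2 := fun i => by rw [← hn]; ring
      refine ⟨n, 1, s - 2, fun i => by rw [hx]; simp, ?_⟩
      simp only [hx, Finset.sum_add_distrib, Finset.sum_const, Finset.card_univ,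
        Fintype.card_fin] at hs
      have : ((∑ i, n i : ℤ) : ℚ) = (2 * (s - 2) : ℤ) := by
        push_cast
        norm_num at hs
        linarith
      exact_mod_cast this
  · rintro ⟨n, h, s, hx, hs⟩
    refine ⟨?_, s + 2 * h, ?_⟩
    · obtain ⟨e, rfl | rfl⟩ := Int.even_or_odd' h
      · exact .inl fun i => ⟨n i + e, by rw [hx]; push_cast; ring⟩
      · exact .inr fun i => ⟨n i + e, by rw [hx]; push_cast; ring⟩
    · have hs' : (∑ i, (n i : ℚ)) = 2 * s := by exact_mod_cast hs
      simp only [hx, Finset.sum_add_distrib, Finset.sum_const, Finset.card_univ, Fintype.card_fin,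
        hs']
      push_cast
      ring

theorem inE8_sub_smul {x y : Fin 8 → ℚ} (hx : InE8 x) (hy : InE8 y) (c : ℤ) :
    InE8 (x - (c : ℚ) • y) := by
  rw [inE8_iff] at *
  obtain ⟨n, h, s, hx, hs⟩ := hx
  obtain ⟨n', h', s', hy, hs'⟩ := hy
  refine ⟨fun i => n i - c * n' i, h - c * h', s - c * s', fun i => ?_, ?_⟩
  · simp only [Pi.sub_apply, Pi.smul_apply, smul_eq_mul, hx, hy]
    push_cast
    ring
  · rw [Finset.sum_sub_distrib, ← Finset.mul_sum, hs, hs']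
    ring

theorem exists_E8dot_eq_intCast {x y : Fin 8 → ℚ} (hx : InE8 x) (hy : InE8 y) :
    ∃ c : ℤ, E8dot x y = c := by
  rw [inE8_iff] at *
  obtain ⟨n, h, s, hx, hs⟩ := hx
  obtain ⟨n', h', s', hy, hs'⟩ := hy
  refine ⟨∑ i, n i * n' i + h' * s + h * s' + 2 * h * h', ?_⟩
  have hs : (∑ i, (n i : ℚ)) = 2 * s := by exact_mod_cast hs
  have hs' : (∑ i, (n' i : ℚ)) = 2 * s' := by exact_mod_cast hs'
  rw [Fin.sum_univ_eight] at hs hs'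
  simp only [E8dot, hx, hy, Fin.sum_univ_eight]
  push_cast
  linear_combination (h' / 2 : ℚ) * hs + (h / 2 : ℚ) * hs'

/-- The permutations of `ℚ^8` that preserve the roots and the dot product. -/
def rootIsos : Subgroup (Equiv.Perm (Fin 8 → ℚ)) where
  carrier := {g | (∀ x, IsE8Root (g x) ↔ IsE8Root x) ∧ ∀ x y, E8dot (g x) (g y) = E8dot x y}
  one_mem' := ⟨fun _ => Iff.rfl, fun _ _ => rfl⟩
  mul_mem' := fun {g h} hg hh => ⟨fun x => (hg.1 (h x)).trans (hh.1 x),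
    fun x y => (hg.2 (h x) (h y)).trans (hh.2 x y)⟩
  inv_mem' := fun {g} hg => by
    have h : ∀ x, g (g⁻¹ x) = x := g.apply_symm_apply
    exact ⟨fun x => by rw [← hg.1, h], fun x y => by rw [← hg.2, h, h]⟩

/-- The reflection in the hyperplane orthogonal to `a`. -/
def reflection (a x : Fin 8 → ℚ) : Fin 8 → ℚ := x - E8dot x a • a

theorem reflection_involutive {a : Fin 8 → ℚ} (ha : E8dot a a = 2) :
    Function.Involutive (reflection a) := by
  intro x
  simp only [reflection, E8dot_sub_left, E8dot_smul_left, ha]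
  module

theorem reflection_mem_rootIsos {a : Fin 8 → ℚ} (ha : IsE8Root a) :
    (reflection_involutive ha.2).toPerm ∈ rootIsos := by
  have hdot : ∀ x y, E8dot (reflection a x) (reflection a y) = E8dot x y := fun x y => by
    simp only [reflection, E8dot_sub_left, E8dot_smul_left, E8dot_sub_right, E8dot_smul_right,
      ha.2, E8dot_comm a y]
    ring
  have hroot : ∀ x, IsE8Root x → IsE8Root (reflection a x) := fun x hx => by
    obtain ⟨c, hc⟩ := exists_E8dot_eq_intCast hx.1 ha.1
    refine ⟨?_, (hdot x x).trans hx.2⟩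
    rw [reflection, hc]
    exact inE8_sub_smul hx.1 ha.1 c
  refine ⟨fun x => ⟨fun h => ?_, hroot x⟩, hdot⟩
  have := hroot _ h
  rwa [Function.Involutive.coe_toPerm, reflection_involutive ha.2] at this

/-- Two vectors are conjugate over `S` if some isometry of the root system that fixes `S`
pointwise maps one to the other. -/
def Conj (S : List (Fin 8 → ℚ)) (x y : Fin 8 → ℚ) : Prop :=
  ∃ g ∈ rootIsos, (∀ s ∈ S, g s = s) ∧ g x = y

variable {S : List (Fin 8 → ℚ)} {x y z : Fin 8 → ℚ}

theorem Conj.refl (S : List (Fin 8 → ℚ)) (x : Fin 8 → ℚ) : Conj S x x :=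
  ⟨1, one_mem _, fun _ _ => rfl, rfl⟩

theorem Conj.symm : Conj S x y → Conj S y x := by
  rintro ⟨g, hg, hS, rfl⟩
  refine ⟨g⁻¹, inv_mem hg, fun s hs => ?_, by simp⟩
  rw [Equiv.Perm.inv_eq_iff_eq, hS s hs]

theorem Conj.trans : Conj S x y → Conj S y z → Conj S x z := by
  rintro ⟨g, hg, hS, rfl⟩ ⟨h, hh, hS', rfl⟩
  exact ⟨h * g, mul_mem hh hg, fun s hs => by rw [Equiv.Perm.mul_apply, hS s hs, hS' s hs], rfl⟩

theorem Conj.of_E8dot_eq_one (hx : IsE8Root x) (hy : IsE8Root y) (hxy : E8dot x y = 1)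
    (hS : ∀ s ∈ S, E8dot s x = E8dot s y) : Conj S x y := by
  have ha : IsE8Root (x - y) := by
    refine ⟨by simpa using inE8_sub_smul hx.1 hy.1 1, ?_⟩
    rw [E8dot_sub_left, E8dot_sub_right, E8dot_sub_right, E8dot_comm y x, hx.2, hy.2, hxy]
    norm_num
  refine ⟨_, reflection_mem_rootIsos ha, fun s hs => ?_, ?_⟩
  · simp [reflection, E8dot_sub_right, hS s hs]
  · simp only [Function.Involutive.coe_toPerm, reflection, E8dot_sub_right, hx.2, hxy]
    module

/-- Decides whether every vertex of a list but the last has dot product `1` with a later one. -/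
def isChain : List (List ℕ) → Bool
  | [] => true
  | a :: L => (L.isEmpty || L.any (dotIs 12 a)) && isChain L

theorem conj_of_isChain {L : List (List ℕ)} (hL : isChain L = true) (hcodes : ∀ a ∈ L, a ∈ codes)
    (hS : ∀ s ∈ S, ∀ a ∈ L, ∀ b ∈ L, E8dot s (vec a) = E8dot s (vec b)) :
    ∀ a ∈ L, ∀ b ∈ L, Conj S (vec a) (vec b) := by
  induction L with
  | nil => simp
  | cons c L ih =>
    simp only [isChain, Bool.and_eq_true, Bool.or_eq_true, List.isEmpty_iff, List.any_eq_true] at hL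
    simp only [List.mem_cons, forall_eq_or_imp] at hcodes hS
    have ih := ih hL.2 hcodes.2 fun s hs a ha b hb => (hS s hs).2 a ha |>.2 b hb
    have hc : ∀ a ∈ L, Conj S (vec c) (vec a) := fun a ha => by
      rcases hL.1 with rfl | ⟨b, hb, hcb⟩
      · simp at ha
      · refine Conj.trans ?_ (ih b hb a ha)
        rw [dotIs_iff (length_eq_of_mem_codes hcodes.1)
          (length_eq_of_mem_codes (hcodes.2 b hb))] at hcb
        exact Conj.of_E8dot_eq_one (isE8Root_vec hcodes.1) (isE8Root_vec (hcodes.2 b hb))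
          (by push_cast at hcb; linarith) fun s hs => (hS s hs).1.2 b hb
    simp only [List.mem_cons, forall_eq_or_imp]
    exact ⟨⟨Conj.refl _ _, hc⟩, fun a ha => ⟨(hc a ha).symm, ih a ha⟩⟩

end Isometries

section RootGraph

/-- The graph on `ℚ^8` whose edges are the pairs with dot product `0` or `-1`. -/
def rootGraph : SimpleGraph (Fin 8 → ℚ) where
  Adj x y := x ≠ y ∧ (E8dot x y = 0 ∨ E8dot x y = -1)
  symm := ⟨fun x y h => ⟨h.1.symm, by rw [E8dot_comm]; exact h.2⟩⟩
  loopless := ⟨fun _ h => h.1 rfl⟩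

/-- The set of roots of the E8 lattice. -/
def roots : Finset (Fin 8 → ℚ) := (codes.map vec).toFinset

theorem mem_roots {x : Fin 8 → ℚ} : x ∈ roots ↔ IsE8Root x := by
  simp only [roots, List.mem_toFinset, List.mem_map]
  constructor
  · rintro ⟨l, hl, rfl⟩
    exact isE8Root_vec hl
  · exact exists_code_of_isE8Root

open scoped Classical in
/-- The roots that are adjacent to all vectors in `S`. -/
noncomputable def nbr (S : List (Fin 8 → ℚ)) : Finset (Fin 8 → ℚ) :=
  {y ∈ roots | ∀ x ∈ S, rootGraph.Adj x y}

theorem mem_nbr {S : List (Fin 8 → ℚ)} {y : Fin 8 → ℚ} :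
    y ∈ nbr S ↔ IsE8Root y ∧ ∀ x ∈ S, rootGraph.Adj x y := by
  simp [nbr, mem_roots]

open scoped Classical in
theorem nbr_cons (x : Fin 8 → ℚ) (S : List (Fin 8 → ℚ)) :
    nbr (x :: S) = {y ∈ nbr S | rootGraph.Adj x y} := by
  ext y
  simp only [mem_nbr, Finset.mem_filter, List.mem_cons, forall_eq_or_imp]
  tauto

theorem card_cliquesIn_nbr_map {g : Equiv.Perm (Fin 8 → ℚ)} (hg : g ∈ rootIsos) (k : ℕ)
    (S : List (Fin 8 → ℚ)) :
    (cliquesIn rootGraph k (nbr (S.map g))).card = (cliquesIn rootGraph k (nbr S)).card := by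
  let e : rootGraph ≃g rootGraph :=
    ⟨g, fun {x y} => by simp only [rootGraph, hg.2, ne_eq, EmbeddingLike.apply_eq_iff_eq]⟩
  suffices h : nbr (S.map g) = (nbr S).map e.toEquiv.toEmbedding by
    rw [h, card_cliquesIn_map]
  ext y
  obtain ⟨x, rfl⟩ := g.surjective y
  have h : (g x ∈ (nbr S).map e.toEquiv.toEmbedding) ↔ x ∈ nbr S :=
    Finset.mem_map' e.toEquiv.toEmbedding
  rw [h]
  simp only [mem_nbr, hg.1, List.mem_map, forall_exists_index, and_imp, forall_apply_eq_imp_iff₂]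
  exact and_congr Iff.rfl (forall₂_congr fun s _ => e.map_adj_iff)

theorem Conj.card_cliquesIn_nbr_eq {S : List (Fin 8 → ℚ)} {x y : Fin 8 → ℚ} (h : Conj S x y)
    (k : ℕ) : (cliquesIn rootGraph k (nbr (x :: S))).card =
      (cliquesIn rootGraph k (nbr (y :: S))).card := by
  obtain ⟨g, hg, hS, rfl⟩ := h
  rw [← card_cliquesIn_nbr_map hg, List.map_cons, List.map_congr_left hS, List.map_id']

theorem rootGraph_adj_of_E8dot_eq_zero {x y : Fin 8 → ℚ} (hx : IsE8Root x)
    (h : E8dot x y = 0) : rootGraph.Adj x y := by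
  refine ⟨?_, .inl h⟩
  rintro rfl
  rw [hx.2] at h
  norm_num at h

theorem ncard_rootCliques_eq {r₁ r₂ : Fin 8 → ℚ} (h₁ : IsE8Root r₁) (h₂ : IsE8Root r₂)
    (horth : E8dot r₁ r₂ = 0) :
    {S : Finset (Fin 8 → ℚ) | r₁ ∈ S ∧ r₂ ∈ S ∧ IsRootClique8 S}.ncard =
      (cliquesIn rootGraph 6 (nbr [r₂, r₁])).card := by
  classical
  have hadj := rootGraph_adj_of_E8dot_eq_zero h₁ horth
  have h := card_cliquesIn_filter_mem (G := rootGraph) (k := 6 + 1) (fun T => r₂ ∈ T)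
    (mem_roots.2 h₁)
  have h' := card_cliquesIn_filter_mem (G := rootGraph) (k := 6) (fun _ => True)
    (Finset.mem_filter.2 ⟨mem_roots.2 h₂, hadj⟩)
  simp only [and_true, Finset.filter_true] at h'
  have hnil : nbr [] = roots := by simp [nbr]
  rw [nbr_cons, nbr_cons, hnil]
  refine Eq.trans ?_ (h.trans (Eq.trans (by congr!) h'))
  rw [← Set.ncard_coe_finset]
  refine congrArg Set.ncard (Set.ext fun S => ?_)
  simp only [Set.mem_ofPred_eq, Finset.coe_filter, mem_cliquesIn, Finset.mem_erase, IsRootClique8,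
    SimpleGraph.isClique_iff, Set.Pairwise, Finset.mem_coe, Finset.subset_iff, mem_roots,
    Nat.reduceAdd]
  constructor
  · rintro ⟨hr₁, hr₂, h8, hS, hSS⟩
    exact ⟨⟨hS, h8, fun x hx y hy hxy => ⟨hxy, hSS x hx y hy hxy⟩⟩, hr₁, hadj.1.symm, hr₂⟩
  · rintro ⟨⟨hS, h8, hSS⟩, hr₁, -, hr₂⟩
    exact ⟨hr₁, hr₂, h8, hS, fun x hx y hy hxy => (hSS hx hy hxy).2⟩

/-- The code of the first root of a fixed orthogonal pair. -/
def fstCode : List ℕ := [4, 4, 2, 2, 2, 2, 2, 2]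

/-- The code of the second root of a fixed orthogonal pair. -/
def sndCode : List ℕ := [4, 0, 2, 2, 2, 2, 2, 2]

theorem card_cliquesIn_nbr_pair {r₁ r₂ : Fin 8 → ℚ} (h₁ : IsE8Root r₁) (h₂ : IsE8Root r₂)
    (horth : E8dot r₁ r₂ = 0) (k : ℕ) :
    (cliquesIn rootGraph k (nbr [r₂, r₁])).card =
      (cliquesIn rootGraph k (nbr [vec sndCode, vec fstCode])).card := by
  have hfst : fstCode ∈ codes := by decide +kernel
  have hsnd : sndCode ∈ codes.filter (dotIs 8 fstCode) := by decide +kernel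
  have hchain : isChain codes = true := by decide +kernel
  have hchain' : isChain (codes.filter (dotIs 8 fstCode)) = true := by decide +kernel
  obtain ⟨a, ha, rfl⟩ := exists_code_of_isE8Root h₁
  obtain ⟨g, hg, -, hga⟩ :=
    conj_of_isChain (S := []) hchain (fun _ h => h) (by simp) a ha fstCode hfst
  obtain ⟨b, hb, hgb⟩ := exists_code_of_isE8Root ((hg.1 r₂).2 h₂)
  have hdot : ∀ c ∈ codes.filter (dotIs 8 fstCode), E8dot (vec fstCode) (vec c) = 0 := by
    intro c hc
    obtain ⟨hc, h⟩ := List.mem_filter.1 hc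
    rw [dotIs_iff (length_eq_of_mem_codes hfst) (length_eq_of_mem_codes hc)] at h
    push_cast at h
    linarith
  rw [← card_cliquesIn_nbr_map hg, List.map_cons, List.map_cons, List.map_nil, hga, ← hgb]
  refine Conj.card_cliquesIn_nbr_eq (conj_of_isChain hchain'
    (fun c hc => (List.mem_filter.1 hc).1) ?_ b ?_ sndCode hsnd) k
  · intro s hs c hc d hd
    rw [List.mem_singleton.1 hs, hdot c hc, hdot d hd]
  · rw [List.mem_filter, dotIs_iff (length_eq_of_mem_codes hfst) (length_eq_of_mem_codes hb), hgb,
      ← hga, hg.2, horth]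
    exact ⟨hb, by norm_num⟩

end RootGraph

section Bitsets

variable {α : Type*}

/-- Applies a function to a natural number after evaluating the latter. -/
def force {α : Sort*} (n : ℕ) (f : ℕ → α) : α :=
  Nat.rec (f 0) (fun m _ => f (Nat.succ m)) n

@[simp]
theorem force_eq {α : Sort*} (n : ℕ) (f : ℕ → α) : force n f = f n := by cases n <;> rfl

/-- The sublist of a list selected by the binary digits of a number. -/
def sel (P : ℕ) (L : List α) : List α :=
  List.rec (fun _ => []) (fun v _ ih P => force (Nat.div P 2) fun Q =>
    bif Nat.beq (Nat.mod P 2) 1 then v :: ih Q else ih Q) L P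

@[simp]
theorem sel_nil (P : ℕ) : sel P ([] : List α) = [] := rfl

theorem sel_cons (P : ℕ) (v : α) (L : List α) :
    sel P (v :: L) = if P % 2 = 1 then v :: sel (P / 2) L else sel (P / 2) L := by
  simp only [sel, force_eq]
  by_cases h : P % 2 = 1
  · have h' : Nat.mod P 2 = 1 := h
    rw [if_pos h, h']
    rfl
  · have h' : Nat.mod P 2 = 0 := Nat.mod_two_ne_one.1 h
    rw [if_neg h, h']
    rfl

theorem sel_two_mul (P : ℕ) (v : α) (L : List α) : sel (2 * P) (v :: L) = sel P L := by
  rw [sel_cons, if_neg (by omega), Nat.mul_div_cancel_left _ two_pos]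

theorem sel_two_mul_add_one (P : ℕ) (v : α) (L : List α) :
    sel (2 * P + 1) (v :: L) = v :: sel P L := by
  rw [sel_cons, if_pos (by omega), show (2 * P + 1) / 2 = P by omega]

@[simp]
theorem sel_zero (L : List α) : sel 0 L = [] := by
  induction L with
  | nil => rfl
  | cons v L ih => simpa using (sel_two_mul 0 v L).trans ih

theorem sel_two_pow_sub_one (L : List α) : sel (2 ^ L.length - 1) L = L := by
  induction L with
  | nil => rfl
  | cons v L ih =>
    have := Nat.one_le_two_pow (n := L.length)
    rw [List.length_cons, pow_succ,
      show 2 ^ L.length * 2 - 1 = 2 * (2 ^ L.length - 1) + 1 by omega, sel_two_mul_add_one, ih]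

theorem sel_sublist (P : ℕ) (L : List α) : (sel P L).Sublist L := by
  induction L generalizing P with
  | nil => simp
  | cons v L ih =>
    rw [sel_cons]
    split
    · exact (ih _).cons_cons v
    · exact (ih _).cons v

theorem map_sel {β : Type*} (f : α → β) (P : ℕ) (L : List α) :
    (sel P L).map f = sel P (L.map f) := by
  induction L generalizing P with
  | nil => rfl
  | cons v L ih =>
    rw [List.map_cons, sel_cons, sel_cons, ← ih]
    split <;> simp

/-- The number whose binary digits select the elements satisfying `p` from a list. -/
def maskOf (p : α → Bool) : List α → ℕ
  | [] => 0
  | v :: L => Nat.add (bif p v then 1 else 0) (Nat.mul 2 (maskOf p L))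

theorem maskOf_cons (p : α → Bool) (v : α) (L : List α) :
    maskOf p (v :: L) = (bif p v then 1 else 0) + 2 * maskOf p L := rfl

theorem sel_land_maskOf (p : α → Bool) (P : ℕ) (L : List α) :
    sel (P &&& maskOf p L) L = (sel P L).filter p := by
  induction L generalizing P with
  | nil => rfl
  | cons v L ih =>
    have hdiv : (P &&& maskOf p (v :: L)) / 2 = P / 2 &&& maskOf p L := by
      rw [Nat.and_div_two, maskOf_cons]
      congr 1
      cases p v <;> simp
      omega
    have hmod : (P &&& maskOf p (v :: L)) % 2 = 1 ↔ P % 2 = 1 ∧ p v = true := by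
      rw [Nat.and_mod_two_eq_one, maskOf_cons]
      cases p v <;> simp
    rw [sel_cons, sel_cons, hdiv, ih]
    by_cases h₁ : P % 2 = 1 <;> cases h₂ : p v <;> simp [hmod, h₁, h₂]

theorem maskOf_drop (p : α → Bool) (n : ℕ) (L : List α) :
    maskOf p L / 2 ^ n = maskOf p (L.drop n) := by
  induction n generalizing L with
  | zero => simp
  | succ n ih =>
    cases L with
    | nil => simp [maskOf]
    | cons v L =>
      rw [List.drop_succ_cons, ← ih, pow_succ', ← Nat.div_div_eq_div_mul, maskOf_cons]
      congr 1
      cases p v <;> simp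
      omega

theorem two_mul_land_two_mul_add_one (a b : ℕ) : 2 * a &&& (2 * b + 1) = 2 * (a &&& b) := by
  refine Nat.eq_of_testBit_eq fun i => ?_
  cases i with
  | zero => simp
  | succ i =>
    rw [Nat.testBit_succ, Nat.testBit_succ, Nat.and_div_two, show (2 * b + 1) / 2 = b by omega,
      Nat.mul_div_cancel_left _ two_pos, Nat.mul_div_cancel_left _ two_pos]

theorem land_pred (t R : ℕ) :
    2 ^ t * (2 * R + 1) &&& (2 ^ t * (2 * R + 1) - 1) = 2 ^ t * (2 * R) := by
  induction t with
  | zero =>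
    rw [pow_zero, one_mul, one_mul, Nat.add_sub_cancel, Nat.and_comm, two_mul_land_two_mul_add_one,
      Nat.and_self]
  | succ t ih =>
    have : 0 < 2 ^ t * (2 * R + 1) := by positivity
    rw [pow_succ', mul_assoc, mul_assoc,
      show 2 * (2 ^ t * (2 * R + 1)) - 1 = 2 * (2 ^ t * (2 * R + 1) - 1) + 1 by omega,
      two_mul_land_two_mul_add_one, ih]

theorem land_mod_two_pow {P n : ℕ} (hP : P < 2 ^ n) (X : ℕ) : P &&& X % 2 ^ n = P &&& X := by
  rw [← Nat.and_two_pow_sub_one_eq_mod, ← Nat.and_assoc, Nat.and_right_comm,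
    Nat.and_two_pow_sub_one_eq_mod, Nat.mod_eq_of_lt hP]

end Bitsets

section Loop

variable {α : Type*} (adj : α → α → Bool) (w m T : ℕ)

/-- The number `T` stores the adjacencies of the first vertex in `w` digits at a position given by
the key, and those of the `i`th vertex at the position given by `2 ^ i` times the key. Only the
adjacencies to later vertices are stored, and keys are taken modulo `m`. -/
def IsTable : ℕ → List α → Prop
  | _, [] => True
  | key, v :: L => T / 2 ^ (w * (key % m)) % 2 ^ L.length = maskOf (adj v) L ∧
      IsTable (2 * key) L

variable {adj w m T}

theorem IsTable.congr {key key' : ℕ} {L : List α} (h : IsTable adj w m T key L)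
    (hkey : key ≡ key' [MOD m]) : IsTable adj w m T key' L := by
  induction L generalizing key key' with
  | nil => trivial
  | cons v L ih =>
    refine ⟨?_, ih h.2 (hkey.mul_left 2)⟩
    rw [← hkey]
    exact h.1

theorem IsTable.exists_sel {key t R : ℕ} {L : List α} (h : IsTable adj w m T key L)
    (hP : 2 ^ t * (2 * R + 1) < 2 ^ L.length) :
    ∃ v L', L'.length < L.length ∧ IsTable adj w m T (key * 2 ^ t) (v :: L') ∧
      R < 2 ^ L'.length ∧ sel (2 ^ t * (2 * R + 1)) L = v :: sel R L' := by
  induction t generalizing key L with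
  | zero =>
    cases L with
    | nil => simp at hP
    | cons v L =>
      rw [List.length_cons, pow_succ, pow_zero] at hP
      exact ⟨v, L, by simp, by simpa using h, by omega,
        by rw [pow_zero, one_mul, sel_two_mul_add_one]⟩
  | succ t ih =>
    cases L with
    | nil =>
      have : 0 < 2 ^ (t + 1) * (2 * R + 1) := by positivity
      simp at hP
    | cons v L =>
      rw [List.length_cons, pow_succ', pow_succ', mul_assoc] at hP
      obtain ⟨u, L', h₁, h₂, h₃, h₄⟩ := ih h.2 (Nat.lt_of_mul_lt_mul_left hP)
      refine ⟨u, L', h₁.trans (by simp), ?_, h₃, ?_⟩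
      · rwa [show key * 2 ^ (t + 1) = 2 * key * 2 ^ t by ring]
      · rw [pow_succ', mul_assoc, sel_two_mul, h₄]

/-- The function `g` counts `k`-element cliques in sets of vertices given by binary digits, using
the table `T`. -/
def CountsCliques (adj : α → α → Bool) (w m T N : ℕ) (g : ℕ → ℕ → ℕ) (k : ℕ) : Prop :=
  ∀ (key : ℕ) (L : List α) (P : ℕ), IsTable adj w m T key L → L.length ≤ N → P < 2 ^ L.length →
    g key P = cliqueCount adj k (sel P L)

/-- Adds up the values of `g` at the sets of later neighbours of the vertices in `P`. -/
def loop (w m T : ℕ) (g : ℕ → ℕ → ℕ) (N : ℕ) : ℕ → ℕ → ℕ :=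
  Nat.rec (fun _ _ => 0) (fun _ ih key P =>
    Nat.rec 0 (fun q _ =>
      force (Nat.land (Nat.succ q) q) fun Q =>
      force (Nat.sub (Nat.succ q) Q) fun low =>
      force (Nat.mod (Nat.mul key low) m) fun key' =>
      force (Nat.div Q (Nat.mul 2 low)) fun R =>
        Nat.add (ih (Nat.mul 2 key') R)
          (g (Nat.mul 2 key') (Nat.land R (Nat.shiftRight T (Nat.mul w key'))))) P) N

theorem loop_succ (g : ℕ → ℕ → ℕ) (N key t R : ℕ) :
    loop w m T g (N + 1) key (2 ^ t * (2 * R + 1)) =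
      loop w m T g N (2 * (key * 2 ^ t % m)) R +
        g (2 * (key * 2 ^ t % m)) (R &&& T / 2 ^ (w * (key * 2 ^ t % m))) := by
  obtain ⟨q, hq⟩ : ∃ q, 2 ^ t * (2 * R + 1) = q + 1 :=
    Nat.exists_eq_succ_of_ne_zero (by positivity)
  have hQ : Nat.land (Nat.succ q) q = 2 ^ t * (2 * R) := by
    have := land_pred t R
    rwa [hq, Nat.add_sub_cancel] at this
  have hlow : Nat.sub (Nat.succ q) (2 ^ t * (2 * R)) = 2 ^ t := by
    change q + 1 - _ = _
    rw [← hq, mul_add, mul_one, Nat.add_sub_cancel_left]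
  have hR : Nat.div (2 ^ t * (2 * R)) (Nat.mul 2 (2 ^ t)) = R := by
    change 2 ^ t * (2 * R) / (2 * 2 ^ t) = R
    rw [show 2 ^ t * (2 * R) = 2 * 2 ^ t * R by ring]
    exact Nat.mul_div_cancel_left _ (by positivity)
  have hloop : loop w m T g (N + 1) key (q + 1) =
      force (Nat.land (Nat.succ q) q) fun Q =>
      force (Nat.sub (Nat.succ q) Q) fun low =>
      force (Nat.mod (Nat.mul key low) m) fun key' =>
      force (Nat.div Q (Nat.mul 2 low)) fun R =>
        Nat.add (loop w m T g N (Nat.mul 2 key') R)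
          (g (Nat.mul 2 key') (Nat.land R (Nat.shiftRight T (Nat.mul w key')))) := rfl
  rw [hq, hloop, force_eq, hQ, force_eq, hlow, force_eq, force_eq, hR, ← Nat.shiftRight_eq_div_pow]
  rfl

theorem countsCliques_loop {g : ℕ → ℕ → ℕ} {N k : ℕ} (hg : CountsCliques adj w m T N g k) :
    CountsCliques adj w m T N (loop w m T g N) (k + 1) := by
  suffices ∀ n ≤ N, CountsCliques adj w m T n (loop w m T g n) (k + 1) from this N le_rfl
  intro n hn
  induction n with
  | zero =>
    intro key L P _ hL _
    rw [List.length_eq_zero_iff.1 (Nat.le_zero.1 hL), sel_nil, cliqueCount]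
    rfl
  | succ n ih =>
    intro key L P hT hL hP
    obtain rfl | hP₀ := P.eq_zero_or_pos
    · rw [sel_zero, cliqueCount]
      rfl
    obtain ⟨t, R', ⟨R, rfl⟩, rfl⟩ := Nat.exists_eq_two_pow_mul_odd hP₀.ne'
    obtain ⟨v, L', hL', hT', hR, hsel⟩ := hT.exists_sel hP
    have hT₂ : IsTable adj w m T (2 * (key * 2 ^ t % m)) L' :=
      hT'.2.congr ((Nat.mod_modEq _ _).symm.mul_left 2)
    rw [loop_succ, hsel, cliqueCount, ih (by omega) _ L' _ hT₂ (by omega) hR,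
      ← land_mod_two_pow hR, hT'.1,
      hg _ L' _ hT₂ (by omega) (Nat.and_lt_two_pow _ ?_), sel_land_maskOf]
    rw [← hT'.1]
    exact Nat.mod_lt _ (by positivity)

end Loop

section Popcount

/-- Adds the digits of `P` selected by the mask `M` to the selected digits of `P / 2 ^ s`. -/
def foldBits (s M P : ℕ) : ℕ := Nat.add (Nat.land P M) (Nat.land (Nat.div P (Nat.pow 2 s)) M)

/-- The number of nonzero binary digits of `P`, when the masks consist of sufficiently many, but at
most 31, bytes `85`, `51` and `15`, respectively. -/
def popCount (M₁ M₂ M₃ P : ℕ) : ℕ :=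
  force (foldBits 1 M₁ P) fun Q => force (foldBits 2 M₂ Q) fun R =>
    Nat.mod (foldBits 4 M₃ R) 255

/-- The sum of the first `n` binary digits of a number. -/
def bitSum : ℕ → ℕ → ℕ
  | 0, _ => 0
  | n + 1, P => P % 2 + bitSum n (P / 2)

theorem length_sel {α : Type*} (P : ℕ) (L : List α) : (sel P L).length = bitSum L.length P := by
  induction L generalizing P with
  | nil => rfl
  | cons v L ih =>
    rw [sel_cons, List.length_cons, bitSum, ← ih]
    split <;> simp <;> omega

theorem bitSum_add (n k P : ℕ) : bitSum (n + k) P = bitSum n P + bitSum k (P / 2 ^ n) := by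
  induction n generalizing P with
  | zero => simp [bitSum]
  | succ n ih =>
    rw [Nat.add_right_comm, bitSum, bitSum, ih, pow_succ', Nat.div_div_eq_div_mul, add_assoc]

theorem bitSum_zero (n : ℕ) : bitSum n 0 = 0 := by
  induction n with
  | zero => rfl
  | succ n ih => rw [bitSum, Nat.zero_mod, Nat.zero_div, ih]

theorem bitSum_eq_of_lt {n k P : ℕ} (hnk : n ≤ k) (hP : P < 2 ^ n) : bitSum k P = bitSum n P := by
  obtain ⟨j, rfl⟩ := Nat.exists_eq_add_of_le hnk
  rw [bitSum_add, Nat.div_eq_of_lt hP, bitSum_zero, add_zero]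

theorem bitSum_le (n P : ℕ) : bitSum n P ≤ n := by
  induction n generalizing P with
  | zero => rfl
  | succ n ih =>
    have := ih (P / 2)
    rw [bitSum]
    omega

/-- The number with `n` bytes, all of which are `1`. -/
def ones : ℕ → ℕ
  | 0 => 0
  | n + 1 => 256 * ones n + 1

theorem land_byte {a b : ℕ} (ha : a < 256) (hb : b < 256) (x y : ℕ) :
    (256 * x + a) &&& (256 * y + b) = 256 * (x &&& y) + (a &&& b) := by
  rw [show 256 = 2 ^ 8 from rfl] at *
  have hab : a &&& b < 2 ^ 8 := Nat.and_lt_two_pow a hb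
  refine Nat.eq_of_testBit_eq fun i => ?_
  simp only [Nat.testBit_and, Nat.testBit_two_pow_mul_add _ ha, Nat.testBit_two_pow_mul_add _ hb,
    Nat.testBit_two_pow_mul_add _ hab]
  split <;> simp

theorem foldBits_byte {s r c : ℕ} (hs : s + r = 8) (hc : c < 2 ^ r) {d : ℕ} (hd : d < 256)
    (n Q : ℕ) : foldBits s (c * ones (n + 1)) (256 * Q + d) =
      256 * foldBits s (c * ones n) Q + foldBits s c d := by
  have h256 : 256 = 2 ^ s * 2 ^ r := by rw [← pow_add, hs]; rfl
  have hc' : c < 256 := hc.trans_le (Nat.pow_le_pow_right two_pos (by omega : r ≤ 8))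
  have hlow : d / 2 ^ s < 2 ^ r := Nat.div_lt_of_lt_mul (h256 ▸ hd)
  have hdiv : (256 * Q + d) / 2 ^ s = 256 * (Q / 2 ^ s) + (2 ^ r * (Q % 2 ^ s) + d / 2 ^ s) := by
    rw [h256, mul_assoc, Nat.mul_add_div (by positivity), ← add_assoc]
    congr 1
    conv_lhs => rw [← Nat.div_add_mod Q (2 ^ s)]
    ring
  have hbyte : 2 ^ r * (Q % 2 ^ s) + d / 2 ^ s < 256 := by
    have := Nat.mod_lt Q (show 0 < 2 ^ s by positivity)
    calc _ < 2 ^ r * (Q % 2 ^ s) + 2 ^ r := by omega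
      _ = (Q % 2 ^ s + 1) * 2 ^ r := by ring
      _ ≤ 2 ^ s * 2 ^ r := Nat.mul_le_mul_right _ this
      _ = 256 := h256.symm
  have hland : (2 ^ r * (Q % 2 ^ s) + d / 2 ^ s) &&& c = d / 2 ^ s &&& c := by
    rw [Nat.and_comm, ← land_mod_two_pow hc, Nat.mul_add_mod, Nat.mod_eq_of_lt hlow, Nat.and_comm]
  have hmask : c * ones (n + 1) = 256 * (c * ones n) + c := by rw [ones]; ring
  change ((256 * Q + d) &&& _) + ((256 * Q + d) / 2 ^ s &&& _) =
    256 * ((Q &&& _) + (Q / 2 ^ s &&& _)) + ((d &&& c) + (d / 2 ^ s &&& c))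
  rw [hmask, hdiv, land_byte hd hc', land_byte hbyte hc', hland]
  ring

theorem popCount_byte : ∀ d < 256, foldBits 1 85 d < 256 ∧
    foldBits 2 51 (foldBits 1 85 d) < 256 ∧
      foldBits 4 15 (foldBits 2 51 (foldBits 1 85 d)) = bitSum 8 d := by
  decide +kernel

theorem bitSum_eight (Q d : ℕ) : bitSum 8 (256 * Q + d) = bitSum 8 d := by
  simp only [bitSum]
  omega

theorem foldBits_modEq_bitSum (n P : ℕ) :
    foldBits 4 (15 * ones n) (foldBits 2 (51 * ones n) (foldBits 1 (85 * ones n) P)) ≡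
      bitSum (8 * n) P [MOD 255] := by
  induction n generalizing P with
  | zero =>
    have h : ∀ s c P, foldBits s (c * ones 0) P = 0 := fun s c P => by
      change (P &&& c * 0) + (P / 2 ^ s &&& c * 0) = 0
      simp
    rw [h]
    rfl
  | succ n ih =>
    obtain ⟨Q, d, hd, rfl⟩ : ∃ Q d, d < 256 ∧ P = 256 * Q + d :=
      ⟨P / 256, P % 256, Nat.mod_lt _ (by norm_num), (Nat.div_add_mod P 256).symm⟩
    obtain ⟨h₁, h₂, h₃⟩ := popCount_byte d hd
    rw [foldBits_byte (r := 7) rfl (by norm_num) hd, foldBits_byte (r := 6) rfl (by norm_num) h₁,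
      foldBits_byte (r := 4) rfl (by norm_num) h₂, h₃, mul_add, mul_one, add_comm (8 * n),
      bitSum_add, bitSum_eight, show (256 * Q + d) / 2 ^ 8 = Q by omega, add_comm]
    refine Nat.ModEq.add_left _ ?_
    simpa using Nat.ModEq.mul (show 256 ≡ 1 [MOD 255] from rfl) (ih Q)

theorem popCount_eq {α : Type*} {n P : ℕ} {L : List α} (hn : n < 32) (hL : L.length ≤ 8 * n)
    (hP : P < 2 ^ L.length) :
    popCount (85 * ones n) (51 * ones n) (15 * ones n) P = (sel P L).length := by
  rw [length_sel, ← bitSum_eq_of_lt hL hP, popCount, force_eq, force_eq]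
  have := foldBits_modEq_bitSum n P
  rwa [Nat.ModEq, Nat.mod_eq_of_lt (a := bitSum _ _)] at this
  exact (bitSum_le _ _).trans_lt (by omega)

theorem cliqueCount_one {α : Type*} (adj : α → α → Bool) (L : List α) :
    cliqueCount adj 1 L = L.length := by
  induction L with
  | nil => rw [cliqueCount, List.length_nil]
  | cons v L ih => rw [cliqueCount, cliqueCount, ih, List.length_cons]

theorem countsCliques_popCount {α : Type*} (adj : α → α → Bool) (w m T : ℕ) {n : ℕ}
    (hn : n < 32) : CountsCliques adj w m T (8 * n)
      (fun _ => popCount (85 * ones n) (51 * ones n) (15 * ones n)) 1 :=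
  fun _ L P _ hL hP => by
    rw [cliqueCount_one]
    exact popCount_eq hn hL hP

end Popcount

section Entries

/-- Applies a function to a list of digits after evaluating the latter. -/
def forceCode {γ : Type*} : List ℕ → (List ℕ → γ) → γ
  | [], f => f []
  | a :: l, f => force a fun a => forceCode l fun l => f (a :: l)

/-- Applies a function to a list of codes after evaluating the latter. -/
def forceCodes {γ : Type*} : List (List ℕ) → (List (List ℕ) → γ) → γ
  | [], f => f []
  | l :: L, f => forceCode l fun l => forceCodes L fun L => f (l :: L)

/-- Applies a function to the list of all pairs consisting of a code in `L` and the mask of its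
neighbours in `M`, after evaluating these pairs. -/
def forceEntries {γ : Type*} (M : List (List ℕ)) :
    List (List ℕ) → (List (List ℕ × ℕ) → γ) → γ
  | [], f => f []
  | l :: L, f => force (maskOf (adjC l) M) fun r => forceEntries M L fun E => f ((l, r) :: E)

theorem forceCode_eq {γ : Type*} (l : List ℕ) (f : List ℕ → γ) : forceCode l f = f l := by
  induction l generalizing f with
  | nil => rfl
  | cons a l ih => rw [forceCode, force_eq, ih]

theorem forceCodes_eq {γ : Type*} (L : List (List ℕ)) (f : List (List ℕ) → γ) :
    forceCodes L f = f L := by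
  induction L generalizing f with
  | nil => rfl
  | cons l L ih => rw [forceCodes, forceCode_eq, ih]

/-- The pairs consisting of a code in `L` and the mask of its neighbours in `M`. -/
def entries (M L : List (List ℕ)) : List (List ℕ × ℕ) := L.map fun l => (l, maskOf (adjC l) M)

theorem forceEntries_eq {γ : Type*} (M L : List (List ℕ)) (f : List (List ℕ × ℕ) → γ) :
    forceEntries M L f = f (entries M L) := by
  induction L generalizing f with
  | nil => rfl
  | cons l L ih => rw [forceEntries, force_eq, ih]; rfl

/-- A table for the rows of the given entries, the first of which has index `i`. -/
def tableOf (w m : ℕ) : ℕ → ℕ → List (List ℕ × ℕ) → ℕ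
  | _, _, [] => 0
  | key, i, e :: E =>
      force (Nat.mod (Nat.mul 2 key) m) fun key' => force (Nat.succ i) fun j =>
        Nat.add (Nat.mul (Nat.div e.2 (Nat.pow 2 j)) (Nat.pow 2 (Nat.mul w key)))
          (tableOf w m key' j E)

/-- Decides whether a number is a table for the rows of the given entries, the first of which has
index `i`. -/
def checkTable (w m T : ℕ) : ℕ → ℕ → List (List ℕ × ℕ) → Bool
  | _, _, [] => true
  | key, i, e :: E =>
      force (Nat.succ i) fun j =>
        Nat.beq (Nat.mod (Nat.div T (Nat.pow 2 (Nat.mul w (Nat.mod key m)))) (Nat.pow 2 E.length))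
          (Nat.div e.2 (Nat.pow 2 j)) &&
        force (Nat.mul 2 key) fun key' => checkTable w m T key' j E

theorem isTable_of_checkTable {w m T : ℕ} {M : List (List ℕ)} {key i : ℕ} {L : List (List ℕ)}
    (hL : M.drop i = L) (h : checkTable w m T key i (entries M L) = true) :
    IsTable adjC w m T key L := by
  induction L generalizing key i with
  | nil => trivial
  | cons l L ih =>
    simp only [entries, List.map_cons, checkTable, force_eq, Bool.and_eq_true, Nat.beq_eq,
      List.length_map] at h
    have hL' : M.drop (i + 1) = L := by rw [← List.drop_drop, hL]; rfl
    refine ⟨?_, ih hL' h.2⟩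
    rw [← hL', ← maskOf_drop, hL']
    exact h.1

end Entries

section Count

/-- Decides whether two codes have dot product `1` with each other, and the same dot product with
each element of `S`. -/
def areClose (S : List (List ℕ)) (a b : List ℕ) : Bool :=
  dotIs 12 a b && S.all fun s =>
    Nat.beq (Nat.add (digitDot s a) (Nat.mul 2 (digitSum b)))
      (Nat.add (digitDot s b) (Nat.mul 2 (digitSum a)))

theorem conj_of_areClose {S : List (List ℕ)} {a b : List ℕ} (hS : ∀ s ∈ S, s ∈ codes)
    (ha : a ∈ codes) (hb : b ∈ codes) (h : areClose S a b = true) :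
    Conj (S.map vec) (vec a) (vec b) := by
  have ha' := length_eq_of_mem_codes ha
  have hb' := length_eq_of_mem_codes hb
  simp only [areClose, Bool.and_eq_true, List.all_eq_true, Nat.beq_eq] at h
  rw [dotIs_iff ha' hb'] at h
  refine Conj.of_E8dot_eq_one (isE8Root_vec ha) (isE8Root_vec hb)
    (by have := h.1; push_cast at this; linarith) fun x hx => ?_
  obtain ⟨s, hs, rfl⟩ := List.mem_map.1 hx
  have hs' := length_eq_of_mem_codes (hS s hs)
  have h₁ := digitDot_add_forty hs' ha'
  have h₂ := digitDot_add_forty hs' hb'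
  have h₃ : (digitDot s a + 2 * digitSum b : ℚ) = digitDot s b + 2 * digitSum a := by
    exact_mod_cast h.2 s hs
  linarith

/-- The value of `f` at an entry, which is looked up if it is known for a close code. -/
def lookup (f : List ℕ × ℕ → ℕ) (S : List (List ℕ)) (e : List ℕ × ℕ) : List (List ℕ × ℕ) → ℕ
  | [] => f e
  | v :: V => bif areClose S e.1 v.1 then v.2 else lookup f S e V

/-- The sum of `n` and the values of `f` at the given entries, where `V` is a list of codes with
known values. -/
def orbitSum (f : List ℕ × ℕ → ℕ) (S : List (List ℕ)) :
    List (List ℕ × ℕ) → List (List ℕ × ℕ) → ℕ → ℕ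
  | [], _, n => n
  | e :: E, V, n => force (lookup f S e V) fun x => force (Nat.add n x) fun n' =>
      orbitSum f S E ((e.1, x) :: V) n'

theorem lookup_eq {f : List ℕ × ℕ → ℕ} {S : List (List ℕ)} {e : List ℕ × ℕ}
    {V : List (List ℕ × ℕ)} {g : List ℕ → ℕ} (hfe : f e = g e.1)
    (hV : ∀ v ∈ V, v.2 = g v.1 ∧ (areClose S e.1 v.1 = true → g e.1 = g v.1)) :
    lookup f S e V = g e.1 := by
  induction V with
  | nil => exact hfe
  | cons v V ih =>
    simp only [List.mem_cons, forall_eq_or_imp] at hV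
    rw [lookup]
    cases h : areClose S e.1 v.1
    · exact ih hV.2
    · rw [cond_true, hV.1.1, hV.1.2 h]

theorem orbitSum_eq {f : List ℕ × ℕ → ℕ} {S : List (List ℕ)} {M : List (List ℕ)}
    {g : List ℕ → ℕ} (hg : ∀ a ∈ M, ∀ b ∈ M, areClose S a b = true → g a = g b)
    (E V : List (List ℕ × ℕ)) (n : ℕ) (hE : ∀ e ∈ E, e.1 ∈ M ∧ f e = g e.1)
    (hV : ∀ v ∈ V, v.1 ∈ M ∧ v.2 = g v.1) :
    orbitSum f S E V n = n + (E.map fun e => g e.1).sum := by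
  induction E generalizing V n with
  | nil => rfl
  | cons e E ih =>
    simp only [List.mem_cons, forall_eq_or_imp] at hE
    have he : lookup f S e V = g e.1 := lookup_eq hE.1.2 fun v hv =>
      ⟨(hV v hv).2, hg _ hE.1.1 _ (hV v hv).1⟩
    rw [orbitSum, force_eq, force_eq, he, ih _ _ hE.2, List.map_cons, List.sum_cons, ← add_assoc]
    · rfl
    · simp only [List.mem_cons, forall_eq_or_imp]
      exact ⟨⟨hE.1.1, trivial⟩, hV⟩

/-- Counts `k`-element cliques in the common neighbourhood of `S`, given as a mask `P`, by double
counting the flags of cliques of sizes up to `d`, and by means of `brute` after that. -/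
def count (E : List (List ℕ × ℕ)) (brute : ℕ → ℕ) : ℕ → ℕ → List (List ℕ) → ℕ → ℕ
  | 0, _, _, P => brute P
  | d + 1, k, S, P =>
      Nat.div (orbitSum (fun e => force (Nat.land P e.2) (count E brute d (Nat.pred k) (e.1 :: S)))
        S (sel P E) [] 0) k

theorem adjC_iff {a b : List ℕ} (ha : a ∈ codes) (hb : b ∈ codes) :
    adjC a b = true ↔ rootGraph.Adj (vec a) (vec b) := by
  have h : ∀ c, dotIs c a b = true ↔ _ := fun c =>
    dotIs_iff (length_eq_of_mem_codes ha) (length_eq_of_mem_codes hb)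
  rw [adjC, Bool.or_eq_true, h, h]
  constructor
  · intro h
    have h' : E8dot (vec a) (vec b) = 0 ∨ E8dot (vec a) (vec b) = -1 :=
      h.imp (fun h => by push_cast at h; linarith) (fun h => by push_cast at h; linarith)
    refine ⟨fun heq => ?_, h'⟩
    rw [← heq, (isE8Root_vec ha).2] at h'
    norm_num at h'
  · rintro ⟨-, h | h⟩ <;> rw [h]
    · exact .inl (by norm_num)
    · exact .inr (by norm_num)

theorem count_eq {M : List (List ℕ)} (hM : ∀ a ∈ M, a ∈ codes) (hnodup : M.Nodup)
    {brute : ℕ → ℕ} {j : ℕ}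
    (hbrute : ∀ P < 2 ^ M.length, brute P = cliqueCount adjC j (sel P M)) (d : ℕ) (P : ℕ)
    (S : List (List ℕ)) (hP : P < 2 ^ M.length) (hS : ∀ s ∈ S, s ∈ codes)
    (hsel : ∀ a ∈ codes, a ∈ sel P M ↔ vec a ∈ nbr (S.map vec)) :
    count (entries M M) brute d (j + d) S P =
      (cliquesIn rootGraph (j + d) (nbr (S.map vec))).card := by
  classical
  have hcodes : ∀ P, ∀ a ∈ sel P M, a ∈ codes := fun P a ha => hM a ((sel_sublist P M).subset ha)
  have hmap : ∀ P, ((sel P M).map vec).Nodup := fun P =>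
    (hnodup.sublist (sel_sublist P M)).map_on fun a ha b hb h => vec_injOn
      (length_eq_of_mem_codes (hcodes P a ha)) (length_eq_of_mem_codes (hcodes P b hb)) h
  have hnbr : ∀ (P : ℕ) (S : List (List ℕ)),
      (∀ a ∈ codes, a ∈ sel P M ↔ vec a ∈ nbr (S.map vec)) →
      ((sel P M).map vec).toFinset = nbr (S.map vec) := by
    intro P S hsel
    ext x
    rw [List.mem_toFinset, List.mem_map]
    constructor
    · rintro ⟨a, ha, rfl⟩
      exact (hsel a (hcodes P a ha)).1 ha
    · intro hx
      obtain ⟨a, ha, rfl⟩ := exists_code_of_isE8Root (mem_nbr.1 hx).1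
      exact ⟨a, (hsel a ha).2 hx, rfl⟩
  induction d generalizing P S with
  | zero =>
    rw [count, hbrute P hP, add_zero, ← hnbr P S hsel]
    convert (card_cliquesIn_toFinset adjC vec j _ (hmap P)
      fun a ha b hb => adjC_iff (hcodes P a ha) (hcodes P b hb)).symm
  | succ d ih =>
    let g : List ℕ → ℕ := fun a => (cliquesIn rootGraph (j + d) (nbr (vec a :: S.map vec))).card
    have hfst : ∀ P, (sel P (entries M M)).map Prod.fst = sel P M := fun P => by
      rw [map_sel, entries, List.map_map]
      exact congrArg _ (List.map_id' M)
    have hmem : ∀ e ∈ sel P (entries M M), e.1 ∈ sel P M ∧ e.2 = maskOf (adjC e.1) M := by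
      intro e he
      refine ⟨hfst P ▸ List.mem_map_of_mem he, ?_⟩
      obtain ⟨l, -, rfl⟩ := List.mem_map.1 ((sel_sublist _ _).subset he)
      rfl
    have hsum := orbitSum_eq (S := S) (M := sel P M) (g := g)
      (f := fun e => force (Nat.land P e.2)
        (count (entries M M) brute d (j + d) (e.1 :: S)))
      (fun a ha b hb h => (conj_of_areClose hS (hcodes P a ha) (hcodes P b hb)
        h).card_cliquesIn_nbr_eq _) (sel P (entries M M)) [] 0 (fun e he => by
        obtain ⟨he₁, he₂⟩ := hmem e he
        refine ⟨he₁, ?_⟩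
        have hland : Nat.land P e.2 = P &&& maskOf (adjC e.1) M := by rw [he₂]; rfl
        rw [force_eq, hland]
        refine ih _ (e.1 :: S) ((Nat.and_le_left).trans_lt hP) ?_ fun a ha => ?_
        · simp only [List.mem_cons, forall_eq_or_imp]
          exact ⟨hcodes P _ he₁, hS⟩
        · rw [sel_land_maskOf, List.mem_filter, hsel a ha, adjC_iff (hcodes P _ he₁) ha,
            List.map_cons, nbr_cons, Finset.mem_filter]) (by simp)
    have hcard := succ_mul_card_cliquesIn (G := rootGraph) (k := j + d) (P := nbr (S.map vec))
    have hrhs : ((sel P (entries M M)).map fun e => g e.1).sum =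
        ∑ x ∈ nbr (S.map vec),
          (cliquesIn rootGraph (j + d) {y ∈ nbr (S.map vec) | rootGraph.Adj x y}).card := by
      rw [← hnbr P S hsel, List.sum_toFinset _ (hmap P), List.map_map, ← hfst, List.map_map,
        hfst, hnbr P S hsel]
      refine congrArg List.sum (List.map_congr_left fun e _ => ?_)
      simp only [g, nbr_cons, Function.comp_apply]
    rw [count]
    change orbitSum _ S _ [] 0 / (j + d + 1) = _
    rw [show Nat.pred (j + (d + 1)) = j + d from rfl, hsum, zero_add, hrhs, ← hcard]
    exact Nat.mul_div_cancel_left _ (Nat.succ_pos _)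

end Count

section Computation

/-- The codes of the roots adjacent to both roots of the fixed orthogonal pair. -/
def pairCodes : List (List ℕ) := codes.filter fun c => adjC fstCode c && adjC sndCode c

/-- Counts the three-element cliques in a set of vertices given by binary digits. -/
def brute (T M₁ M₂ M₃ : ℕ) : ℕ → ℕ :=
  loop 136 139 T (loop 136 139 T (fun _ => popCount M₁ M₂ M₃) 136) 136 1

/-- Checks the table of adjacencies between the vertices `M` and counts the six-element cliques. -/
def checkCount (M : List (List ℕ)) (n : ℕ) : Bool :=
  forceCodes M fun M => forceEntries M M fun E => force (tableOf 136 139 1 0 E) fun T =>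
    force (Nat.mul 85 (ones 17)) fun M₁ => force (Nat.mul 51 (ones 17)) fun M₂ =>
    force (Nat.mul 15 (ones 17)) fun M₃ =>
      checkTable 136 139 T 1 0 E &&
        Nat.beq (count E (brute T M₁ M₂ M₃) 3 6 [sndCode, fstCode] (2 ^ 136 - 1)) n

set_option maxRecDepth 100000 in
theorem checkCount_pairCodes : checkCount pairCodes 8963624 = true := by decide +kernel

theorem card_cliquesIn_nbr_fixed_pair :
    (cliquesIn rootGraph 6 (nbr [vec sndCode, vec fstCode])).card = 8963624 := by
  have hlen : pairCodes.length = 136 := by decide +kernel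
  have hnodup : pairCodes.Nodup := by decide +kernel
  have hcodes : ∀ a ∈ pairCodes, a ∈ codes := fun a ha => (List.mem_filter.1 ha).1
  have hS : ∀ s ∈ [sndCode, fstCode], s ∈ codes := by decide +kernel
  have h := checkCount_pairCodes
  simp only [checkCount, forceCodes_eq, forceEntries_eq, force_eq, Bool.and_eq_true,
    Nat.beq_eq] at h
  obtain ⟨hT, h⟩ := h
  rw [← h]
  have hT := isTable_of_checkTable (M := pairCodes) List.drop_zero hT
  refine (count_eq hcodes hnodup (j := 3) (fun P hP => ?_) 3 _ _ ?_ hS fun a ha => ?_).symm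
  · exact countsCliques_loop (countsCliques_loop
      (countsCliques_popCount adjC 136 139 _ (n := 17) (by norm_num))) 1 _ P hT hlen.le hP
  · rw [hlen]
    norm_num
  · rw [← hlen, sel_two_pow_sub_one, pairCodes, List.mem_filter, mem_nbr]
    simp only [List.map_cons, List.map_nil, List.mem_cons, List.not_mem_nil, or_false,
      forall_eq_or_imp, forall_eq, Bool.and_eq_true,
      adjC_iff (hS _ (List.mem_cons_self ..)) ha,
      adjC_iff (hS fstCode (List.mem_cons_of_mem _ (List.mem_cons_self ..))) ha,
      isE8Root_vec ha, ha, true_and]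
    exact and_comm

end Computation

end RootClique

theorem count_cliques_of_size_eight_through_two_roots
    (r₁ r₂ : Fin 8 → ℚ) (h₁ : IsE8Root r₁) (h₂ : IsE8Root r₂)
    (horth : E8dot r₁ r₂ = 0) :
    {S : Finset (Fin 8 → ℚ) | r₁ ∈ S ∧ r₂ ∈ S ∧ IsRootClique8 S}.ncard = 8963624 := by
  rw [RootClique.ncard_rootCliques_eq h₁ h₂ horth, RootClique.card_cliquesIn_nbr_pair h₁ h₂ horth,
    RootClique.card_cliquesIn_nbr_fixed_pair]
end

section
/- Let k be a field of characteristic 0, let a, b, c, u, v, m ∈ k, and let P1 = (0:1:1), P2 = (0:1:a), P3 = (1:0:1), P4 = (1:0:b), P5 = (1:1:1), P6 = (1:1:u), P7 = (m:1:v), P8 = (m:1:c) in ℙ²(k). Assume P1, …, P8 are in general position and that uvm − um − v² − vm + 2v + m − 1 ≠ 0, cv − cm − c + um² − vm − v − m² + 2m + 1 ≠ 0, cv − cm − c + u − vm − v + m² + 2m − 1 ≠ 0, v − m − 1 ≠ 0, and uv − u − 3v + m + 3 ≠ 0. Then there do not exist nonzero homogeneous cubic forms F1, F2, F3 ∈ k[x,y,z]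 and a point Q ∈ ℙ²(k) such that: Q lies on the line through P1 and P2, on the line through P3 and P4, on the line through P5 and P6, and on the line through P7 and P8; F1 is singular at P1 and vanishes at P3, P4, P5, P6, P7, P8 and at Q; F2 is singular at P3 and vanishes at P1, P2, P5, P6, P7, P8 and at Q; and F3 is singular at P5 and vanishes at P1, P2, P3, P4, P7, P8 and at Q. -/
open MvPolynomial

noncomputable section

variable {k : Type*} [Field k]

/-- The projective plane over `k`. -/
abbrev P2 (k : Type*) [Field k] := Projectivization k (Fin 3 → k)

/-- The point of the projective plane with homogeneous coordinates `(x : y : z)`. -/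
def pt (x y z : k) (h : ![x, y, z] ≠ 0) : P2 k := Projectivization.mk k ![x, y, z] h

lemma ne_zero_fst (x y : k) : ![(1 : k), x, y] ≠ 0 :=
  fun h => (one_ne_zero : (1 : k) ≠ 0) (by simpa using congrFun h 0)

lemma ne_zero_snd (x y : k) : ![x, (1 : k), y] ≠ 0 :=
  fun h => (one_ne_zero : (1 : k) ≠ 0) (by simpa using congrFun h 1)

lemma ne_zero_trd (x y : k) : ![x, y, (1 : k)] ≠ 0 :=
  fun h => (one_ne_zero : (1 : k) ≠ 0) (by simpa using congrFun h 2)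

/-- A homogeneous form vanishes at a projective point. -/
def VanishesAt (F : MvPolynomial (Fin 3) k) (P : P2 k) : Prop :=
  eval P.rep F = 0

/-- A form is singular at a projective point: all three partial derivatives vanish there. -/
def SingularAt (F : MvPolynomial (Fin 3) k) (P : P2 k) : Prop :=
  ∀ i : Fin 3, eval P.rep (pderiv i F) = 0

/-- `Q` lies on the line through `A` and `B`: representatives are linearly dependent. -/
def OnLine (Q A B : P2 k) : Prop :=
  ¬ LinearIndependent k ![Q.rep, A.rep, B.rep]

/-- Eight points of the projective plane are in general position. -/
def GeneralPosition (p : Fin 8 → P2 k) : Prop :=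
  Function.Injective p ∧
  (∀ i j l : Fin 8, i ≠ j → i ≠ l → j ≠ l →
    LinearIndependent k ![(p i).rep, (p j).rep, (p l).rep]) ∧
  (¬ ∃ F : MvPolynomial (Fin 3) k, F ≠ 0 ∧ F.IsHomogeneous 2 ∧
    ∃ s : Finset (Fin 8), s.card = 6 ∧ ∀ i ∈ s, VanishesAt F (p i)) ∧
  (¬ ∃ F : MvPolynomial (Fin 3) k, F ≠ 0 ∧ F.IsHomogeneous 3 ∧
    (∀ i, VanishesAt F (p i)) ∧ ∃ i, SingularAt F (p i))

/-- `P1 = (0:1:1)` -/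
def p1 (k : Type*) [Field k] : P2 k := pt 0 1 1 (ne_zero_snd 0 1)
/-- `P2 = (0:1:a)` -/
def p2 (k : Type*) [Field k] (a : k) : P2 k := pt 0 1 a (ne_zero_snd 0 a)
/-- `P3 = (1:0:1)` -/
def p3 (k : Type*) [Field k] : P2 k := pt 1 0 1 (ne_zero_fst 0 1)
/-- `P4 = (1:0:b)` -/
def p4 (k : Type*) [Field k] (b : k) : P2 k := pt 1 0 b (ne_zero_fst 0 b)
/-- `P5 = (1:1:1)` -/
def p5 (k : Type*) [Field k] : P2 k := pt 1 1 1 (ne_zero_fst 1 1)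
/-- `P6 = (1:1:u)` -/
def p6 (k : Type*) [Field k] (u : k) : P2 k := pt 1 1 u (ne_zero_fst 1 u)
/-- `P7 = (m:1:v)` -/
def p7 (k : Type*) [Field k] (m v : k) : P2 k := pt m 1 v (ne_zero_snd m v)
/-- `P8 = (m:1:c)` -/
def p8 (k : Type*) [Field k] (m c : k) : P2 k := pt m 1 c (ne_zero_snd m c)

/-- The ternary cubic form with the given coefficients, grouped by powers of the third variable. -/
def cubicForm (e l₀ l₁ q₀ q₁ q₂ c₀ c₁ c₂ c₃ : k) : MvPolynomial (Fin 3) k :=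
  C e * X 2 ^ 3 + C l₀ * (X 0 * X 2 ^ 2) + C l₁ * (X 1 * X 2 ^ 2) +
    C q₀ * (X 0 ^ 2 * X 2) + C q₁ * (X 0 * X 1 * X 2) + C q₂ * (X 1 ^ 2 * X 2) +
    C c₀ * X 0 ^ 3 + C c₁ * (X 0 ^ 2 * X 1) + C c₂ * (X 0 * X 1 ^ 2) + C c₃ * X 1 ^ 3

lemma MvPolynomial.IsHomogeneous.exists_eq_cubicForm {F : MvPolynomial (Fin 3) k}
    (hF : F.IsHomogeneous 3) :
    ∃ e l₀ l₁ q₀ q₁ q₂ c₀ c₁ c₂ c₃, F = cubicForm e l₀ l₁ q₀ q₁ q₂ c₀ c₁ c₂ c₃ := by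
  let f (i j l : ℕ) : Fin 3 →₀ ℕ := Finsupp.equivFunOnFinite.symm ![i, j, l]
  have hf (i j l : ℕ) (a : k) :
      monomial (f i j l) a = C a * (X 0 ^ i * X 1 ^ j * X 2 ^ l) := by
    rw [monomial_eq, Finsupp.prod_fintype _ _ (by simp)]
    simp [f, Fin.prod_univ_three]
  have hinj (i j l i' j' l' : ℕ) : f i j l = f i' j' l' ↔ i = i' ∧ j = j' ∧ l = l' := by
    simp [f]
  refine ⟨coeff (f 0 0 3) F, coeff (f 1 0 2) F, coeff (f 0 1 2) F, coeff (f 2 0 1) F,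
    coeff (f 1 1 1) F, coeff (f 0 2 1) F, coeff (f 3 0 0) F, coeff (f 2 1 0) F,
    coeff (f 1 2 0) F, coeff (f 0 3 0) F, ?_⟩
  have hsum (e l₀ l₁ q₀ q₁ q₂ c₀ c₁ c₂ c₃ : k) : cubicForm e l₀ l₁ q₀ q₁ q₂ c₀ c₁ c₂ c₃ =
      monomial (f 0 0 3) e + monomial (f 1 0 2) l₀ + monomial (f 0 1 2) l₁ +
      monomial (f 2 0 1) q₀ + monomial (f 1 1 1) q₁ + monomial (f 0 2 1) q₂ +
      monomial (f 3 0 0) c₀ + monomial (f 2 1 0) c₁ + monomial (f 1 2 0) c₂ +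
      monomial (f 0 3 0) c₃ := by
    simp [cubicForm, hf]
  rw [hsum]
  ext d
  obtain ⟨i, j, l, rfl⟩ : ∃ i j l, d = f i j l :=
    ⟨d 0, d 1, d 2, by ext n; fin_cases n <;> rfl⟩
  simp only [coeff_add, coeff_monomial, hinj]
  by_cases h : i + j + l = 3
  · have hi : i ≤ 3 := by omega
    have hj : j ≤ 3 := by omega
    obtain rfl : l = 3 - i - j := by omega
    interval_cases i <;> interval_cases j <;> simp at h ⊢
  · rw [hF.coeff_eq_zero (by simpa [f, Finsupp.degree_eq_sum, Fin.sum_univ_three] using h)]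
    repeat rw [if_neg (by omega)]
    simp

lemma exists_rep_pt (x y z : k) (h : ![x, y, z] ≠ 0) :
    ∃ r : k, r ≠ 0 ∧ (pt x y z h).rep = ![r * x, r * y, r * z] := by
  obtain ⟨r, hr⟩ := Projectivization.exists_smul_eq_mk_rep k ![x, y, z] h
  refine ⟨r, r.ne_zero, ?_⟩
  rw [pt, ← hr]
  ext i
  fin_cases i <;> simp [Units.smul_def]

lemma linearIndependent_fin_three_iff (A B D : Fin 3 → k) :
    LinearIndependent k ![A, B, D] ↔
      A 0 * (B 1 * D 2 - B 2 * D 1) - A 1 * (B 0 * D 2 - B 2 * D 0) +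
        A 2 * (B 0 * D 1 - B 1 * D 0) ≠ 0 := by
  have h := Matrix.linearIndependent_rows_iff_isUnit (A := Matrix.of ![A, B, D])
  rw [Matrix.isUnit_iff_isUnit_det, isUnit_iff_ne_zero, Matrix.det_fin_three] at h
  refine h.trans (not_congr ?_)
  simp only [Matrix.of_apply, Matrix.cons_val]
  constructor <;> intro h <;> linear_combination h

lemma linearIndependent_rep_pt_iff {x y z x' y' z' x'' y'' z'' : k} (h : ![x, y, z] ≠ 0)
    (h' : ![x', y', z'] ≠ 0) (h'' : ![x'', y'', z''] ≠ 0) :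
    LinearIndependent k ![(pt x y z h).rep, (pt x' y' z' h').rep, (pt x'' y'' z'' h'').rep] ↔
      x * (y' * z'' - z' * y'') - y * (x' * z'' - z' * x'') + z * (x' * y'' - y' * x'') ≠ 0 := by
  obtain ⟨r, hr, e⟩ := exists_rep_pt x y z h
  obtain ⟨r', hr', e'⟩ := exists_rep_pt x' y' z' h'
  obtain ⟨r'', hr'', e''⟩ := exists_rep_pt x'' y'' z'' h''
  rw [linearIndependent_fin_three_iff, e, e', e'']
  have h0 : r * r' * r'' ≠ 0 := by simp [hr, hr', hr'']
  refine not_congr (Iff.trans ?_ (mul_eq_zero_iff_left h0))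
  simp only [Matrix.cons_val]
  constructor <;> intro h <;> linear_combination h

lemma vanishesAt_cubicForm_pt {e l₀ l₁ q₀ q₁ q₂ c₀ c₁ c₂ c₃ x y z : k} {h : ![x, y, z] ≠ 0} :
    VanishesAt (cubicForm e l₀ l₁ q₀ q₁ q₂ c₀ c₁ c₂ c₃) (pt x y z h) ↔
      e * z ^ 3 + (l₀ * x + l₁ * y) * z ^ 2 + (q₀ * x ^ 2 + q₁ * x * y + q₂ * y ^ 2) * z +
        (c₀ * x ^ 3 + c₁ * x ^ 2 * y + c₂ * x * y ^ 2 + c₃ * y ^ 3) = 0 := by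
  obtain ⟨r, hr, hrep⟩ := exists_rep_pt x y z h
  rw [VanishesAt, hrep]
  refine Iff.trans ?_ (mul_eq_zero_iff_left (pow_ne_zero 3 hr))
  simp only [cubicForm, map_add, map_mul, map_pow, eval_C, eval_X, Matrix.cons_val]
  constructor <;> intro h <;> linear_combination h

lemma singularAt_cubicForm_pt {e l₀ l₁ q₀ q₁ q₂ c₀ c₁ c₂ c₃ x y z : k} {h : ![x, y, z] ≠ 0}
    (hs : SingularAt (cubicForm e l₀ l₁ q₀ q₁ q₂ c₀ c₁ c₂ c₃) (pt x y z h)) :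
    l₀ * z ^ 2 + (2 * q₀ * x + q₁ * y) * z + (3 * c₀ * x ^ 2 + 2 * c₁ * x * y + c₂ * y ^ 2) = 0 ∧
    l₁ * z ^ 2 + (q₁ * x + 2 * q₂ * y) * z + (c₁ * x ^ 2 + 2 * c₂ * x * y + 3 * c₃ * y ^ 2) = 0 ∧
    3 * e * z ^ 2 + 2 * (l₀ * x + l₁ * y) * z + (q₀ * x ^ 2 + q₁ * x * y + q₂ * y ^ 2) = 0 := by
  obtain ⟨r, hr, hrep⟩ := exists_rep_pt x y z h
  have h0 := hs 0
  have h1 := hs 1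
  have h2 := hs 2
  rw [hrep] at h0 h1 h2
  simp only [cubicForm, map_add, Derivation.leibniz, Derivation.leibniz_pow, pderiv_C, pderiv_X,
    map_mul, map_pow, eval_C, eval_X, Matrix.cons_val, smul_eq_mul, nsmul_eq_mul, Pi.single_apply,
    Fin.reduceEq, if_true, if_false, map_one, map_zero, map_natCast] at h0 h1 h2
  have hr2 := pow_ne_zero 2 hr
  refine ⟨?_, ?_, ?_⟩ <;> apply mul_left_cancel₀ hr2
  · push_cast at h0; linear_combination h0
  · push_cast at h1; linear_combination h1
  · push_cast at h2; linear_combination h2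

/-- The lines `P₁P₂` and `P₃P₄` meet in `(0 : 0 : 1)`, so a cubic form vanishing at their
intersection has no `z ^ 3` term. -/
lemma eq_zero_of_vanishesAt_cubicForm {e l₀ l₁ q₀ q₁ q₂ c₀ c₁ c₂ c₃ a b : k} {Q : P2 k}
    (ha : a - 1 ≠ 0) (hb : b - 1 ≠ 0)
    (hQ₁ : OnLine Q (p1 k) (p2 k a)) (hQ₂ : OnLine Q (p3 k) (p4 k b))
    (h : VanishesAt (cubicForm e l₀ l₁ q₀ q₁ q₂ c₀ c₁ c₂ c₃) Q) : e = 0 := by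
  induction Q using Projectivization.ind with
  | h w hw =>
  obtain ⟨x, y, z, rfl⟩ : ∃ x y z, w = ![x, y, z] :=
    ⟨w 0, w 1, w 2, by ext n; fin_cases n <;> rfl⟩
  change OnLine (pt x y z hw) _ _ at hQ₁ hQ₂
  change VanishesAt _ (pt x y z hw) at h
  rw [OnLine, p1, p2, linearIndependent_rep_pt_iff, not_not] at hQ₁
  rw [OnLine, p3, p4, linearIndependent_rep_pt_iff, not_not] at hQ₂
  obtain rfl : x = 0 := mul_right_cancel₀ ha (by linear_combination hQ₁)
  obtain rfl : y = 0 := mul_right_cancel₀ hb (by linear_combination -hQ₂)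
  have hz : z ≠ 0 := by
    rintro rfl
    exact hw (by ext n; fin_cases n <;> rfl)
  rw [vanishesAt_cubicForm_pt] at h
  exact mul_right_cancel₀ (pow_ne_zero 3 hz) (by linear_combination h)

/-- A polynomial `l z² + q z + c` with distinct roots `s` and `t` is `l (z - s) (z - t)`. -/
lemma quadratic_coeffs_of_roots {l q c s t : k} (hst : t - s ≠ 0)
    (hs : l * s ^ 2 + q * s + c = 0) (ht : l * t ^ 2 + q * t + c = 0) :
    q = -(s + t) * l ∧ c = s * t * l := by
  have hq : q = -(s + t) * l := mul_left_cancel₀ hst (by linear_combination ht - hs)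
  exact ⟨hq, by linear_combination hs - s * hq⟩

lemma eq_zero_of_two_linear {e₁₁ e₁₂ e₂₁ e₂₂ x y : k} (hdet : e₁₁ * e₂₂ - e₁₂ * e₂₁ ≠ 0)
    (h₁ : e₁₁ * x + e₁₂ * y = 0) (h₂ : e₂₁ * x + e₂₂ * y = 0) : x = 0 ∧ y = 0 :=
  ⟨mul_left_cancel₀ hdet (by linear_combination e₂₂ * h₁ - e₁₂ * h₂),
    mul_left_cancel₀ hdet (by linear_combination e₁₁ * h₂ - e₂₁ * h₁)⟩

lemma det_eq_zero_of_singularAt_p1 [CharZero k] {a b c u v m : k} {F : MvPolynomial (Fin 3) k}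
    {Q : P2 k} (ha : a - 1 ≠ 0) (hb : b - 1 ≠ 0) (hu : u - 1 ≠ 0) (hc : c - v ≠ 0) (hm : m ≠ 0)
    (hm' : m - 1 ≠ 0) (hF₀ : F ≠ 0) (hF : F.IsHomogeneous 3)
    (hQ₁ : OnLine Q (p1 k) (p2 k a)) (hQ₂ : OnLine Q (p3 k) (p4 k b)) (hQ : VanishesAt F Q)
    (hs : SingularAt F (p1 k))
    (h3 : VanishesAt F (p3 k)) (h4 : VanishesAt F (p4 k b))
    (h5 : VanishesAt F (p5 k)) (h6 : VanishesAt F (p6 k u))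
    (h7 : VanishesAt F (p7 k m v)) (h8 : VanishesAt F (p8 k m c)) :
    b*(c*m - c*v + c - u*m^2 + v*m + v + m^2 - 2*m - 1) + (u - 2)*(v - 1)*(c - 1) = 0 := by
  obtain ⟨e, l₀, l₁, q₀, q₁, q₂, c₀, c₁, c₂, c₃, rfl⟩ := hF.exists_eq_cubicForm
  obtain rfl := eq_zero_of_vanishesAt_cubicForm ha hb hQ₁ hQ₂ hQ
  obtain ⟨hs₀, hs₁, hs₂⟩ := singularAt_cubicForm_pt hs
  rw [p3, vanishesAt_cubicForm_pt] at h3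
  rw [p4, vanishesAt_cubicForm_pt] at h4
  rw [p5, vanishesAt_cubicForm_pt] at h5
  rw [p6, vanishesAt_cubicForm_pt] at h6
  rw [p7, vanishesAt_cubicForm_pt] at h7
  rw [p8, vanishesAt_cubicForm_pt] at h8
  obtain ⟨hq3, hc3⟩ := quadratic_coeffs_of_roots (l := l₀) (q := q₀)
    (c := c₀) hb (by linear_combination h3) (by linear_combination h4)
  obtain ⟨hq5, hc5⟩ := quadratic_coeffs_of_roots (l := l₀ + l₁) (q := q₀ + q₁ + q₂)
    (c := c₀ + c₁ + c₂ + c₃) hu (by linear_combination h5) (by linear_combination h6)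
  obtain ⟨hq7, hc7⟩ := quadratic_coeffs_of_roots (l := l₀ * m + l₁) (q := q₀ * m ^ 2 + q₁ * m + q₂)
    (c := c₀ * m ^ 3 + c₁ * m ^ 2 + c₂ * m + c₃) hc (by linear_combination h7) (by linear_combination h8)
  obtain rfl : q₂ = -2 * l₁ := by linear_combination hs₂
  obtain rfl : q₀ = -(1 + b) * l₀ := by linear_combination hq3
  obtain rfl : c₀ = b * l₀ := by linear_combination hc3
  obtain rfl : l₁ = c₃ := by linear_combination -(hs₁ - 2*hs₂)/3
  obtain rfl : q₁ = -(l₀ + l₁)*(1+u) + (1 + b) * l₀ + 2*l₁ := by linear_combination hq5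
  obtain rfl : c₂ = -l₀ + (l₀ + l₁)*(1+u) - (1 + b) * l₀ - 2*l₁ := by linear_combination hs₀
  obtain rfl : c₁ = (l₀ + l₁)*u - b*l₀ - l₁ + l₀ - (l₀ + l₁)*(1+u) + (1 + b) * l₀ + 2*l₁ := by
    linear_combination hc5
  by_contra hD
  have hdet : (-b*m^2 + b*m + c*m - u*m + v*m - m^2) * (-c*v + u*m - m + 1) -
      (c - u*m + v + m - 2) * (b*m^3 - b*m - c*v*m + u*m + m^2 - m) ≠ 0 := by
    have := mul_ne_zero (mul_ne_zero hm hm') hD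
    contrapose! this
    linear_combination -this
  obtain ⟨rfl, rfl⟩ := eq_zero_of_two_linear (x := l₀) (y := l₁) hdet
    (by linear_combination hq7) (by linear_combination hc7)
  exact hF₀ (by simp [cubicForm])

lemma det_eq_zero_of_singularAt_p3 [CharZero k] {a b c u v m : k} {F : MvPolynomial (Fin 3) k}
    {Q : P2 k} (ha : a - 1 ≠ 0) (hb : b - 1 ≠ 0) (hu : u - 1 ≠ 0) (hc : c - v ≠ 0) (hm : m ≠ 0)
    (hm' : m - 1 ≠ 0) (hF₀ : F ≠ 0) (hF : F.IsHomogeneous 3)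
    (hQ₁ : OnLine Q (p1 k) (p2 k a)) (hQ₂ : OnLine Q (p3 k) (p4 k b)) (hQ : VanishesAt F Q)
    (hs : SingularAt F (p3 k))
    (h1 : VanishesAt F (p1 k)) (h2 : VanishesAt F (p2 k a))
    (h5 : VanishesAt F (p5 k)) (h6 : VanishesAt F (p6 k u))
    (h7 : VanishesAt F (p7 k m v)) (h8 : VanishesAt F (p8 k m c)) :
    a*(c*m - c*v + c - u + v*m + v - m^2 - 2*m + 1) + (u - 2)*(v - m)*(c - m) = 0 := by
  obtain ⟨e, l₀, l₁, q₀, q₁, q₂, c₀, c₁, c₂, c₃, rfl⟩ := hF.exists_eq_cubicForm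
  obtain rfl := eq_zero_of_vanishesAt_cubicForm ha hb hQ₁ hQ₂ hQ
  obtain ⟨hs₀, hs₁, hs₂⟩ := singularAt_cubicForm_pt hs
  rw [p1, vanishesAt_cubicForm_pt] at h1
  rw [p2, vanishesAt_cubicForm_pt] at h2
  rw [p5, vanishesAt_cubicForm_pt] at h5
  rw [p6, vanishesAt_cubicForm_pt] at h6
  rw [p7, vanishesAt_cubicForm_pt] at h7
  rw [p8, vanishesAt_cubicForm_pt] at h8
  obtain ⟨hq1, hc1⟩ := quadratic_coeffs_of_roots (l := l₁) (q := q₂)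
    (c := c₃) ha (by linear_combination h1) (by linear_combination h2)
  obtain ⟨hq5, hc5⟩ := quadratic_coeffs_of_roots (l := l₀ + l₁) (q := q₀ + q₁ + q₂)
    (c := c₀ + c₁ + c₂ + c₃) hu (by linear_combination h5) (by linear_combination h6)
  obtain ⟨hq7, hc7⟩ := quadratic_coeffs_of_roots (l := l₀ * m + l₁) (q := q₀ * m ^ 2 + q₁ * m + q₂)
    (c := c₀ * m ^ 3 + c₁ * m ^ 2 + c₂ * m + c₃) hc (by linear_combination h7) (by linear_combination h8)
  obtain rfl : q₀ = -2 * l₀ := by linear_combination hs₂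
  obtain rfl : q₂ = -(1 + a) * l₁ := by linear_combination hq1
  obtain rfl : c₃ = a * l₁ := by linear_combination hc1
  obtain rfl : l₀ = c₀ := by linear_combination -(hs₀ - 2*hs₂)/3
  obtain rfl : q₁ = -(l₀ + l₁)*(1+u) + (1 + a) * l₁ + 2*l₀ := by linear_combination hq5
  obtain rfl : c₁ = -l₁ + (l₀ + l₁)*(1+u) - (1 + a) * l₁ - 2*l₀ := by linear_combination hs₁
  obtain rfl : c₂ = (l₀ + l₁)*u - a*l₁ - l₀ + l₁ - (l₀ + l₁)*(1+u) + (1 + a) * l₁ + 2*l₀ := by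
    linear_combination hc5
  by_contra hD
  have hdet : (c*m - u*m + v*m - 2*m^2 + m) * (-a*m^2 + a - c*v + u*m^2 - m^2 + m) -
      (a*m - a + c - u*m + v - 1) * (-c*v*m + u*m^2 + m^3 - m^2) ≠ 0 := by
    have := mul_ne_zero (mul_ne_zero hm hm') hD
    contrapose! this
    linear_combination -this
  obtain ⟨rfl, rfl⟩ := eq_zero_of_two_linear (x := l₀) (y := l₁) hdet
    (by linear_combination hq7) (by linear_combination hc7)
  exact hF₀ (by simp [cubicForm])

lemma det_eq_zero_of_singularAt_p5 [CharZero k] {a b c v m : k} {F : MvPolynomial (Fin 3) k}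
    {Q : P2 k} (ha : a - 1 ≠ 0) (hb : b - 1 ≠ 0) (hc : c - v ≠ 0) (hm : m ≠ 0)
    (hm' : m - 1 ≠ 0) (hF₀ : F ≠ 0) (hF : F.IsHomogeneous 3)
    (hQ₁ : OnLine Q (p1 k) (p2 k a)) (hQ₂ : OnLine Q (p3 k) (p4 k b)) (hQ : VanishesAt F Q)
    (hs : SingularAt F (p5 k))
    (h1 : VanishesAt F (p1 k)) (h2 : VanishesAt F (p2 k a))
    (h3 : VanishesAt F (p3 k)) (h4 : VanishesAt F (p4 k b))
    (h7 : VanishesAt F (p7 k m v)) (h8 : VanishesAt F (p8 k m c)) :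
    -a*b*(m - 1)^2 + a*(v - 1)*(c - 1) + b*(v - m)*(c - m) = 0 := by
  obtain ⟨e, l₀, l₁, q₀, q₁, q₂, c₀, c₁, c₂, c₃, rfl⟩ := hF.exists_eq_cubicForm
  obtain rfl := eq_zero_of_vanishesAt_cubicForm ha hb hQ₁ hQ₂ hQ
  obtain ⟨hs₀, hs₁, hs₂⟩ := singularAt_cubicForm_pt hs
  rw [p1, vanishesAt_cubicForm_pt] at h1
  rw [p2, vanishesAt_cubicForm_pt] at h2
  rw [p3, vanishesAt_cubicForm_pt] at h3
  rw [p4, vanishesAt_cubicForm_pt] at h4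
  rw [p7, vanishesAt_cubicForm_pt] at h7
  rw [p8, vanishesAt_cubicForm_pt] at h8
  obtain ⟨hq1, hc1⟩ := quadratic_coeffs_of_roots (l := l₁) (q := q₂)
    (c := c₃) ha (by linear_combination h1) (by linear_combination h2)
  obtain ⟨hq3, hc3⟩ := quadratic_coeffs_of_roots (l := l₀) (q := q₀)
    (c := c₀) hb (by linear_combination h3) (by linear_combination h4)
  obtain ⟨hq7, hc7⟩ := quadratic_coeffs_of_roots (l := l₀ * m + l₁) (q := q₀ * m ^ 2 + q₁ * m + q₂)
    (c := c₀ * m ^ 3 + c₁ * m ^ 2 + c₂ * m + c₃) hc (by linear_combination h7) (by linear_combination h8)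
  obtain rfl : q₂ = -(1 + a) * l₁ := by linear_combination hq1
  obtain rfl : c₃ = a * l₁ := by linear_combination hc1
  obtain rfl : q₀ = -(1 + b) * l₀ := by linear_combination hq3
  obtain rfl : c₀ = b * l₀ := by linear_combination hc3
  obtain rfl : q₁ = -2*(l₀+l₁) + (1+b)*l₀ + (1+a)*l₁ := by linear_combination hs₂
  obtain rfl : c₁ =
      -(l₀ - 2*(1+b)*l₀ + (-2*(l₀+l₁) + (1+b)*l₀ + (1+a)*l₁) + 3*b*l₀) - (l₀ + l₁ - b*l₀ - a*l₁) := by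
    linear_combination hs₀ - (hs₀+hs₁-2*hs₂)/3
  obtain rfl : c₂ =
      (l₀ + l₁ - b*l₀ - a*l₁) -
        (-(l₀ - 2*(1+b)*l₀ + (-2*(l₀+l₁) + (1+b)*l₀ + (1+a)*l₁) + 3*b*l₀) - (l₀ + l₁ - b*l₀ - a*l₁)) := by
    linear_combination 2*(hs₀+hs₁-2*hs₂)/3-hs₀
  by_contra hD
  have hdet : (-b*m^2 + b*m + c*m + v*m - m^2 - m) * (-a*m + a - c*v + m) -
      (a*m - a + c + v - m - 1) * (b*m^3 - b*m^2 - c*v*m + m^2) ≠ 0 := by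
    have := mul_ne_zero (mul_ne_zero hm hm') hD
    contrapose! this
    linear_combination this
  obtain ⟨rfl, rfl⟩ := eq_zero_of_two_linear (x := l₀) (y := l₁) hdet
    (by linear_combination hq7) (by linear_combination hc7)
  exact hF₀ (by simp [cubicForm])

/-- If the displayed polynomial vanishes, then `P₁, P₃, P₅, P₆, P₇, P₈` lie on a conic. -/
lemma exists_conic {c u v m : k} (hm : m - 1 ≠ 0)
    (h : c*v - c*m - c + u*m - v*m - v + m^2 + 1 = 0) :
    ∃ F : MvPolynomial (Fin 3) k, F ≠ 0 ∧ F.IsHomogeneous 2 ∧ VanishesAt F (p1 k) ∧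
      VanishesAt F (p3 k) ∧ VanishesAt F (p5 k) ∧ VanishesAt F (p6 k u) ∧
      VanishesAt F (p7 k m v) ∧ VanishesAt F (p8 k m c) := by
  let l₀ := (1 + u) - (v + c)
  let l₁ := (v + c) - m * (1 + u)
  let F : MvPolynomial (Fin 3) k := C (m - 1) * (X 2 * X 2) + C l₀ * (X 0 * X 2) +
    C l₁ * (X 1 * X 2) + C (-(m - 1) - l₀) * (X 0 * X 0) + C (m - 1) * (X 0 * X 1) +
    C (-(m - 1) - l₁) * (X 1 * X 1)
  have hmon (a : k) (i j : Fin 3) :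
      (C a * (X i * X j) : MvPolynomial (Fin 3) k).IsHomogeneous 2 :=
    ((isHomogeneous_X k i).mul (isHomogeneous_X k j)).C_mul a
  have hvan {x y z : k} (hne : ![x, y, z] ≠ 0) (hF : (m - 1) * z ^ 2 + (l₀ * x + l₁ * y) * z +
      ((-(m - 1) - l₀) * x ^ 2 + (m - 1) * x * y + (-(m - 1) - l₁) * y ^ 2) = 0) :
      VanishesAt F (pt x y z hne) := by
    obtain ⟨r, -, hrep⟩ := exists_rep_pt x y z hne
    rw [VanishesAt, hrep]
    simp only [F, map_add, map_mul, eval_C, eval_X, Matrix.cons_val]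
    linear_combination r ^ 2 * hF
  refine ⟨F, ?_, ?_, hvan _ ?_, hvan _ ?_, hvan _ ?_, hvan _ ?_, hvan _ ?_, hvan _ ?_⟩
  · intro hF
    have := congrArg (eval ![0, 0, 1]) hF
    simp [F, hm] at this
  · exact (((((hmon _ _ _).add (hmon _ _ _)).add (hmon _ _ _)).add (hmon _ _ _)).add
      (hmon _ _ _)).add (hmon _ _ _)
  · ring
  · ring
  · simp only [l₀, l₁]; ring
  · simp only [l₀, l₁]; ring
  · simp only [l₀, l₁]; linear_combination (1 - m) * h
  · simp only [l₀, l₁]; linear_combination (1 - m) * h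

theorem no_three_singular_cubics_and_four_lines_concurrent
    {k : Type*} [Field k] [CharZero k] (a b c u v m : k)
    (hgen : GeneralPosition
      ![p1 k, p2 k a, p3 k, p4 k b, p5 k, p6 k u, p7 k m v, p8 k m c])
    (h1 : u*v*m - u*m - v^2 - v*m + 2*v + m - 1 ≠ 0)
    (h2 : c*v - c*m - c + u*m^2 - v*m - v - m^2 + 2*m + 1 ≠ 0)
    (h3 : c*v - c*m - c + u - v*m - v + m^2 + 2*m - 1 ≠ 0)
    (h4 : v - m - 1 ≠ 0)
    (h5 : u*v - u - 3*v + m + 3 ≠ 0) :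
    ¬ ∃ (F1 F2 F3 : MvPolynomial (Fin 3) k) (Q : P2 k),
      F1 ≠ 0 ∧ F1.IsHomogeneous 3 ∧ F2 ≠ 0 ∧ F2.IsHomogeneous 3 ∧
      F3 ≠ 0 ∧ F3.IsHomogeneous 3 ∧
      OnLine Q (p1 k) (p2 k a) ∧ OnLine Q (p3 k) (p4 k b) ∧
      OnLine Q (p5 k) (p6 k u) ∧ OnLine Q (p7 k m v) (p8 k m c) ∧
      SingularAt F1 (p1 k) ∧ VanishesAt F1 (p3 k) ∧ VanishesAt F1 (p4 k b) ∧
        VanishesAt F1 (p5 k) ∧ VanishesAt F1 (p6 k u) ∧ VanishesAt F1 (p7 k m v) ∧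
        VanishesAt F1 (p8 k m c) ∧ VanishesAt F1 Q ∧
      SingularAt F2 (p3 k) ∧ VanishesAt F2 (p1 k) ∧ VanishesAt F2 (p2 k a) ∧
        VanishesAt F2 (p5 k) ∧ VanishesAt F2 (p6 k u) ∧ VanishesAt F2 (p7 k m v) ∧
        VanishesAt F2 (p8 k m c) ∧ VanishesAt F2 Q ∧
      SingularAt F3 (p5 k) ∧ VanishesAt F3 (p1 k) ∧ VanishesAt F3 (p2 k a) ∧
        VanishesAt F3 (p3 k) ∧ VanishesAt F3 (p4 k b) ∧ VanishesAt F3 (p7 k m v) ∧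
        VanishesAt F3 (p8 k m c) ∧ VanishesAt F3 Q := by
  rintro ⟨F₁, F₂, F₃, Q, hF₁, hF₁', hF₂, hF₂', hF₃, hF₃', hQ₁, hQ₂, -, -,
    hs₁, h₁3, h₁4, h₁5, h₁6, h₁7, h₁8, h₁Q, hs₂, h₂1, h₂2, h₂5, h₂6, h₂7, h₂8, h₂Q,
    hs₃, h₃1, h₃2, h₃3, h₃4, h₃7, h₃8, h₃Q⟩
  obtain ⟨-, hline, hconic, -⟩ := hgen
  have h123 := hline 0 1 2 (by decide) (by decide) (by decide)
  have h134 := hline 0 2 3 (by decide) (by decide) (by decide)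
  have h136 := hline 0 2 5 (by decide) (by decide) (by decide)
  have h157 := hline 0 4 6 (by decide) (by decide) (by decide)
  have h158 := hline 0 4 7 (by decide) (by decide) (by decide)
  have h178 := hline 0 6 7 (by decide) (by decide) (by decide)
  have h357 := hline 2 4 6 (by decide) (by decide) (by decide)
  have h358 := hline 2 4 7 (by decide) (by decide) (by decide)
  have h567 := hline 4 5 6 (by decide) (by decide) (by decide)
  simp only [Matrix.cons_val, p1, p2, p3, p4, p5, p6, p7, p8, linearIndependent_rep_pt_iff]
    at h123 h134 h136 h157 h158 h178 h357 h358 h567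
  have ha : a - 1 ≠ 0 := by contrapose! h123; linear_combination h123
  have hb : b - 1 ≠ 0 := by contrapose! h134; linear_combination -h134
  have hu : u - 1 ≠ 0 := by contrapose! h567; linear_combination (m - 1) * h567
  have hm' : m - 1 ≠ 0 := by contrapose! h567; linear_combination (u - 1) * h567
  have hm : m ≠ 0 := by contrapose! h178; linear_combination (v - c) * h178
  have hc : c - v ≠ 0 := by contrapose! h178; linear_combination -m * h178
  have hu2 : u - 2 ≠ 0 := by contrapose! h136; linear_combination -h136
  have hv1 : v - 1 ≠ 0 := by contrapose! h157; linear_combination -h157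
  have hc1 : c - 1 ≠ 0 := by contrapose! h158; linear_combination -h158
  have hvm : v - m ≠ 0 := by contrapose! h357; linear_combination h357
  have hcm : c - m ≠ 0 := by contrapose! h358; linear_combination h358
  have hC : c*v - c*m - c + u*m - v*m - v + m^2 + 1 ≠ 0 := by
    intro h
    obtain ⟨F, hF₀, hF, g1, g3, g5, g6, g7, g8⟩ := exists_conic hm' h
    refine hconic ⟨F, hF₀, hF, {0, 2, 4, 5, 6, 7}, by decide, ?_⟩
    simp only [Finset.mem_insert, Finset.mem_singleton]
    rintro i (rfl | rfl | rfl | rfl | rfl | rfl)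
    exacts [g1, g3, g5, g6, g7, g8]
  have d₁ := det_eq_zero_of_singularAt_p1 ha hb hu hc hm hm' hF₁ hF₁' hQ₁ hQ₂ h₁Q hs₁
    h₁3 h₁4 h₁5 h₁6 h₁7 h₁8
  have d₂ := det_eq_zero_of_singularAt_p3 ha hb hu hc hm hm' hF₂ hF₂' hQ₁ hQ₂ h₂Q hs₂
    h₂1 h₂2 h₂5 h₂6 h₂7 h₂8
  have d₃ := det_eq_zero_of_singularAt_p5 ha hb hc hm hm' hF₃ hF₃' hQ₁ hQ₂ h₃Q hs₃
    h₃1 h₃2 h₃3 h₃4 h₃7 h₃8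
  have hprod : 2 * ((u - 2) * (v - 1) * (c - 1) * (v - m) * (c - m) *
      (c*v - c*m - c + u*m - v*m - v + m^2 + 1)) ≠ 0 := by
    simp [hu2, hv1, hc1, hvm, hcm, hC]
  refine hprod ?_
  let B := c*m - c*v + c - u*m^2 + v*m + v + m^2 - 2*m - 1
  let A := c*m - c*v + c - u + v*m + v - m^2 - 2*m + 1
  linear_combination A * B * d₃ - (-(m - 1)^2 * (b * B * d₂ - (u - 2)*(v - m)*(c - m) * d₁) +
    (v - 1)*(c - 1) * B * d₂ + (v - m)*(c - m) * A * d₁)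

end
end

section
/- Let k be a field of characteristic 0, let a, b, c, u, v, m ∈ k, and let P1 = (0:1:1), P2 = (0:1:a), P3 = (1:0:1), P4 = (1:0:b), P5 = (1:1:1), P6 = (1:1:u), P7 = (m:1:v), P8 = (m:1:c) in ℙ²(k). Assume P1, …, P8 are in general position, uvm − um − v² − vm + 2v + m − 1 ≠ 0, and cv − cm − c + um² − vm − v − m² + 2m + 1 ≠ 0. If there exists a nonzero homogeneous cubic form F ∈ k[x,y,z] that is singular at P1, vanishes at P3, P4, P5, P6, P7, P8, and vanishes at (0:0:1), then b(cv − cm − c + um² − vm − v − m² + 2m + 1) = cuv − cu − 2cv + 2c − uv + u + 2v − 2. -/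
open MvPolynomial

noncomputable section

variable {k : Type*} [Field k]

/-- `Q = (0:0:1)` -/
def q0 (k : Type*) [Field k] : P2 k := pt 0 0 1 (ne_zero_trd 0 0)

/-- The value of a homogeneous form at a representative vanishes iff it does at any coordinates. -/
lemma eval_rep_pt_eq_zero_iff {F : MvPolynomial (Fin 3) k} {n : ℕ} (hF : F.IsHomogeneous n)
    (x y z : k) (h : ![x, y, z] ≠ 0) :
    eval (pt x y z h).rep F = 0 ↔ eval ![x, y, z] F = 0 := by
  obtain ⟨r, hr⟩ := Projectivization.exists_smul_eq_mk_rep k ![x, y, z] h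
  have key : eval (pt x y z h).rep F = (r : k) ^ n * eval ![x, y, z] F := by
    rw [pt, ← hr, eval_eq, eval_eq, Finset.mul_sum]
    refine Finset.sum_congr rfl fun d hd => ?_
    have hdeg : ∑ i ∈ d.support, d i = n := by
      by_contra hne
      exact mem_support_iff.mp hd (hF.coeff_eq_zero hne)
    have hsmul : ∀ i, (r • ![x, y, z]) i = (r : k) * ![x, y, z] i := fun _ => rfl
    simp only [hsmul, mul_pow, Finset.prod_mul_distrib, Finset.prod_pow_eq_pow_sum, hdeg]
    ring
  rw [key, mul_eq_zero, or_iff_right (pow_ne_zero n r.ne_zero)]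

/-- A ternary form is a linear combination of the monomials of its degree. -/
lemma exists_eq_sum_monomials {F : MvPolynomial (Fin 3) k} {n : ℕ} (hF : F.IsHomogeneous n) :
    ∃ f : ℕ → ℕ → k, F = ∑ i ∈ Finset.range (n + 1), ∑ j ∈ Finset.range (n + 1 - i),
      C (f i j) * (X 0 ^ i * X 1 ^ j * X 2 ^ (n - i - j)) := by
  have hmon : ∀ d ∈ F.support, F.coeff d • (X 0 ^ d 0 * X 1 ^ d 1 * X 2 ^ (n - d 0 - d 1)) =
      monomial d (F.coeff d) := by
    intro d hd
    have hdeg : d 0 + d 1 + d 2 = n := by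
      by_contra hne
      refine mem_support_iff.mp hd (hF.coeff_eq_zero ?_)
      rwa [Finsupp.degree_eq_sum, Fin.sum_univ_three]
    rw [monomial_eq, Finsupp.prod_fintype _ _ (fun _ => pow_zero _), Fin.prod_univ_three,
      smul_eq_C_mul, show n - d 0 - d 1 = d 2 by lia]
  refine ⟨fun i j => ∑ d ∈ F.support, if d 0 = i ∧ d 1 = j then F.coeff d else 0, ?_⟩
  conv_lhs => rw [F.as_sum]
  simp only [map_sum, Finset.sum_mul]
  rw [Finset.sum_congr rfl fun i _ => Finset.sum_comm, Finset.sum_comm]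
  refine Finset.sum_congr rfl fun d hd => ?_
  have hle : d 0 + d 1 ≤ n := by
    by_contra hne
    refine mem_support_iff.mp hd (hF.coeff_eq_zero ?_)
    rw [Finsupp.degree_eq_sum, Fin.sum_univ_three]
    lia
  rw [Finset.sum_eq_single (d 0), Finset.sum_eq_single (d 1), ← hmon d hd]
  · simp [smul_eq_C_mul]
  · intro j _ hj
    simp [hj.symm]
  · intro h
    exact absurd (Finset.mem_range.mpr (by lia)) h
  · intro i _ hi
    simp [hi.symm]
  · intro h
    exact absurd (Finset.mem_range.mpr (by lia)) h

/-- Points of the plane with linearly independent representatives have coordinate vectors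
of nonzero determinant. -/
lemma det_ne_zero_of_linearIndependent_rep {x y z x' y' z' x'' y'' z'' : k}
    {h : ![x, y, z] ≠ 0} {h' : ![x', y', z'] ≠ 0} {h'' : ![x'', y'', z''] ≠ 0}
    (hli : LinearIndependent k ![(pt x y z h).rep, (pt x' y' z' h').rep, (pt x'' y'' z'' h'').rep]) :
    (!![x, y, z; x', y', z'; x'', y'', z''] : Matrix (Fin 3) (Fin 3) k).det ≠ 0 := by
  obtain ⟨r, hr⟩ := Projectivization.exists_smul_eq_mk_rep k ![x, y, z] h
  obtain ⟨r', hr'⟩ := Projectivization.exists_smul_eq_mk_rep k ![x', y', z'] h'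
  obtain ⟨r'', hr''⟩ := Projectivization.exists_smul_eq_mk_rep k ![x'', y'', z''] h''
  rw [pt, pt, pt, ← hr, ← hr', ← hr''] at hli
  have hvec : ![r • ![x, y, z], r' • ![x', y', z'], r'' • ![x'', y'', z'']] =
      ![r, r', r''] • ![![x, y, z], ![x', y', z'], ![x'', y'', z'']] := by
    ext i : 1
    fin_cases i <;> rfl
  rw [hvec, LinearIndependent.units_smul_iff] at hli
  exact ((Matrix.isUnit_iff_isUnit_det _).mp
    (Matrix.linearIndependent_rows_iff_isUnit.mp hli)).ne_zero

theorem cubic_through_P1_forces_b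
    {k : Type*} [Field k] [CharZero k] (a b c u v m : k)
    (hgen : GeneralPosition
      ![p1 k, p2 k a, p3 k, p4 k b, p5 k, p6 k u, p7 k m v, p8 k m c])
    (h1 : u*v*m - u*m - v^2 - v*m + 2*v + m - 1 ≠ 0)
    (h2 : c*v - c*m - c + u*m^2 - v*m - v - m^2 + 2*m + 1 ≠ 0)
    (hF : ∃ F : MvPolynomial (Fin 3) k, F ≠ 0 ∧ F.IsHomogeneous 3 ∧
      SingularAt F (p1 k) ∧ VanishesAt F (p3 k) ∧ VanishesAt F (p4 k b) ∧
      VanishesAt F (p5 k) ∧ VanishesAt F (p6 k u) ∧ VanishesAt F (p7 k m v) ∧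
      VanishesAt F (p8 k m c) ∧ VanishesAt F (q0 k)) :
    b * (c*v - c*m - c + u*m^2 - v*m - v - m^2 + 2*m + 1) =
      c*u*v - c*u - 2*c*v + 2*c - u*v + u + 2*v - 2 := by
  obtain ⟨hinj, hline, -⟩ := hgen
  have hb : b - 1 ≠ 0 := fun h => by
    have : (2 : Fin 8) = 3 := hinj (by simp [p3, p4, sub_eq_zero.mp h])
    exact absurd this (by decide)
  have hu : u - 1 ≠ 0 := fun h => by
    have : (4 : Fin 8) = 5 := hinj (by simp [p5, p6, sub_eq_zero.mp h])
    exact absurd this (by decide)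
  have hcv : c - v ≠ 0 := fun h => by
    have : (6 : Fin 8) = 7 := hinj (by simp [p7, p8, sub_eq_zero.mp h])
    exact absurd this (by decide)
  have hm0 : m ≠ 0 := fun h => det_ne_zero_of_linearIndependent_rep
    (hline 0 1 6 (by decide) (by decide) (by decide)) (by simp [Matrix.det_fin_three, h])
  have hm1 : m - 1 ≠ 0 := fun h => det_ne_zero_of_linearIndependent_rep
    (hline 4 5 6 (by decide) (by decide) (by decide))
    (by simp [Matrix.det_fin_three, sub_eq_zero.mp h])
  obtain ⟨F, hF0, hF, hs, e3, e4, e5, e6, e7, e8, e0⟩ := hF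
  have s0 := (eval_rep_pt_eq_zero_iff hF.pderiv _ _ _ _).mp (hs 0)
  have s1 := (eval_rep_pt_eq_zero_iff hF.pderiv _ _ _ _).mp (hs 1)
  have s2 := (eval_rep_pt_eq_zero_iff hF.pderiv _ _ _ _).mp (hs 2)
  replace e3 := (eval_rep_pt_eq_zero_iff hF _ _ _ _).mp e3
  replace e4 := (eval_rep_pt_eq_zero_iff hF _ _ _ _).mp e4
  replace e5 := (eval_rep_pt_eq_zero_iff hF _ _ _ _).mp e5
  replace e6 := (eval_rep_pt_eq_zero_iff hF _ _ _ _).mp e6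
  replace e7 := (eval_rep_pt_eq_zero_iff hF _ _ _ _).mp e7
  replace e8 := (eval_rep_pt_eq_zero_iff hF _ _ _ _).mp e8
  replace e0 := (eval_rep_pt_eq_zero_iff hF _ _ _ _).mp e0
  obtain ⟨f, rfl⟩ := exists_eq_sum_monomials hF
  simp [Finset.sum_range_succ, pderiv_X] at s0 s1 s2 e3 e4 e5 e6 e7 e8 e0 hF0
  rw [e0] at s2 e3 e4 e5 e6 e7 e8 hF0
  have h02 : f 0 2 = -2 * f 0 1 := by linear_combination s2
  have h03 : f 0 3 = f 0 1 :=
    mul_left_cancel₀ (three_ne_zero : (3 : k) ≠ 0) (by linear_combination s1 - 2 * h02)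
  have h20 : f 2 0 = -(1 + b) * f 1 0 :=
    mul_left_cancel₀ hb (by linear_combination e4 - e3)
  have h11 : f 1 1 = (1 - u) * f 0 1 + (b - u) * f 1 0 :=
    mul_left_cancel₀ hu (by linear_combination e6 - e5 - (u - 1) * (h02 + h20))
  have h12 : f 1 2 = -f 1 0 - f 1 1 := by linear_combination s0
  have h30 : f 3 0 = b * f 1 0 := by linear_combination e3 - h20
  have h21 : f 2 1 = f 1 0 := by linear_combination e5 - h02 - h03 - h12 - h20 - h30
  have hsum : (m * (1 - u) + v + c - 2) * f 0 1 +
      m * (b * (1 - m) + c + v - u - m) * f 1 0 = 0 :=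
    mul_left_cancel₀ hcv (by
      linear_combination e8 - e7 - (c - v) * (h02 + m * h11 + m ^ 2 * h20))
  have hprod : ((u - 1) * m + 1 - v * c) * f 0 1 +
      m * (b * (m ^ 2 - 1) + m - 1 + u - v * c) * f 1 0 = 0 := by
    linear_combination e7 - v * hsum - v * (h02 + m * h11 + m ^ 2 * h20)
      - h03 - m * h12 - m ^ 2 * h21 - m ^ 3 * h30 + m * h11
  by_contra hne
  have hdet : m * (m - 1) * (b * (c*v - c*m - c + u*m^2 - v*m - v - m^2 + 2*m + 1) -
      (c*u*v - c*u - 2*c*v + 2*c - u*v + u + 2*v - 2)) ≠ 0 :=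
    mul_ne_zero (mul_ne_zero hm0 hm1) (sub_ne_zero.mpr hne)
  have h01 : f 0 1 = 0 := (mul_eq_zero.mp (show _ * f 0 1 = 0 by
    linear_combination m * (b * (1 - m) + c + v - u - m) * hprod -
      m * (b * (m ^ 2 - 1) + m - 1 + u - v * c) * hsum)).resolve_left hdet
  have h10 : f 1 0 = 0 := (mul_eq_zero.mp (show _ * f 1 0 = 0 by
    linear_combination ((u - 1) * m + 1 - v * c) * hsum -
      (m * (1 - u) + v + c - 2) * hprod)).resolve_left hdet
  simp [h02, h03, h20, h12, h30, h21, h11, h01, h10] at hF0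

end
end

section
/- Let k be a field of characteristic 0, let a, b, c, u, v, m ∈ k, and let P1 = (0:1:1), P2 = (0:1:a), P3 = (1:0:1), P4 = (1:0:b), P5 = (1:1:1), P6 = (1:1:u), P7 = (m:1:v), P8 = (m:1:c) in ℙ²(k). Assume P1, …, P8 are in general position, uvm − um − v² − vm + 2v + m − 1 ≠ 0, and cv − cm − c + u − vm − v + m² + 2m − 1 ≠ 0. If there exists a nonzero homogeneous cubic form F ∈ k[x,y,z] that is singular at P3, vanishes at P1, P2, P5, P6, P7, P8, and vanishes at (0:0:1), then a(cv − cm − c + u − vm − v + m² + 2m − 1) = cuv − cum − 2cv + 2cm − uvm + um² + 2vm − 2m². -/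
open MvPolynomial

noncomputable section

variable {k : Type*} [Field k]

lemma eval_smul_of_isHomogeneous {σ : Type*} {F : MvPolynomial σ k} {n : ℕ}
    (hF : F.IsHomogeneous n) (t : k) (x : σ → k) :
    eval (t • x) F = t ^ n * eval x F := by
  simp only [eval_eq, Finset.mul_sum]
  refine Finset.sum_congr rfl fun d hd => ?_
  simp only [Pi.smul_apply, smul_eq_mul, mul_pow, Finset.prod_mul_distrib,
    Finset.prod_pow_eq_pow_sum]
  rw [← hF.degree_eq_sum_deg_support hd]
  ring

lemma eval_rep_mk_eq_zero_iff {F : MvPolynomial (Fin 3) k} {n : ℕ} (hF : F.IsHomogeneous n)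
    (x : Fin 3 → k) (hx : x ≠ 0) :
    eval (Projectivization.mk k x hx).rep F = 0 ↔ eval x F = 0 := by
  obtain ⟨t, ht⟩ := Projectivization.exists_smul_eq_mk_rep k x hx
  rw [← ht, Units.smul_def, eval_smul_of_isHomogeneous hF]
  simp

lemma rep_mk_dotProduct_eq_zero {x w : Fin 3 → k} (hx : x ≠ 0) (h : x ⬝ᵥ w = 0) :
    (Projectivization.mk k x hx).rep ⬝ᵥ w = 0 := by
  obtain ⟨t, ht⟩ := Projectivization.exists_smul_eq_mk_rep k x hx
  rw [← ht, Units.smul_def, smul_dotProduct, h, smul_zero]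

lemma not_linearIndependent_of_dotProduct_eq_zero {x y z w : Fin 3 → k} (hw : w ≠ 0)
    (hx : x ⬝ᵥ w = 0) (hy : y ⬝ᵥ w = 0) (hz : z ⬝ᵥ w = 0) :
    ¬ LinearIndependent k ![x, y, z] := by
  intro hli
  have hunit : IsUnit (Matrix.of ![x, y, z]) :=
    Matrix.linearIndependent_rows_iff_isUnit.mp hli
  have hdet := (Matrix.isUnit_iff_isUnit_det _).mp hunit
  refine hdet.ne_zero (Matrix.exists_mulVec_eq_zero_iff.mp ⟨w, hw, ?_⟩)
  ext i
  fin_cases i <;> simpa [Matrix.mulVec]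

/-- The ten coefficients of a ternary cubic form. -/
lemma exists_coeffs_of_isHomogeneous_three {F : MvPolynomial (Fin 3) k}
    (hF : F.IsHomogeneous 3) :
    ∃ f : (Fin 3 → ℕ) → k, F =
      C (f ![3, 0, 0]) * X 0 ^ 3 + C (f ![0, 3, 0]) * X 1 ^ 3 + C (f ![0, 0, 3]) * X 2 ^ 3
      + C (f ![2, 1, 0]) * (X 0 ^ 2 * X 1) + C (f ![2, 0, 1]) * (X 0 ^ 2 * X 2)
      + C (f ![1, 2, 0]) * (X 0 * X 1 ^ 2) + C (f ![0, 2, 1]) * (X 1 ^ 2 * X 2)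
      + C (f ![1, 0, 2]) * (X 0 * X 2 ^ 2) + C (f ![0, 1, 2]) * (X 1 * X 2 ^ 2)
      + C (f ![1, 1, 1]) * (X 0 * X 1 * X 2) := by
  let e : (Fin 3 →₀ ℕ) ≃ (Fin 3 → ℕ) := Finsupp.equivFunOnFinite
  have hsum : F = ∑ g ∈ Finset.Nat.antidiagonalTuple 3 3,
      C (coeff (e.symm g) F) * ∏ i, (X i : MvPolynomial (Fin 3) k) ^ g i := by
    conv_lhs => rw [← support_sum_monomial_coeff F]
    rw [← Finset.sum_subset (s₁ := F.support.map e.toEmbedding)]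
    · rw [Finset.sum_map]
      refine Finset.sum_congr rfl fun d _ => ?_
      rw [monomial_eq, Finsupp.prod_fintype _ _ (by simp)]
      simp [e]
    · intro g hg
      obtain ⟨d, hd, rfl⟩ := Finset.mem_map.mp hg
      rw [Finset.Nat.mem_antidiagonalTuple]
      have := hF.degree_eq_sum_deg_support hd
      exact (this.trans (Finset.sum_subset (Finset.subset_univ _) (by simp))).symm
    · intro g _ hg
      have : coeff (e.symm g) F = 0 := by
        by_contra h
        exact hg (Finset.mem_map.mpr ⟨e.symm g, mem_support_iff.mpr h, by simp⟩)
      simp [this]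
  refine ⟨fun g => coeff (e.symm g) F, ?_⟩
  have hlist : Finset.Nat.antidiagonalTuple 3 3 =
      {![3, 0, 0], ![0, 3, 0], ![0, 0, 3], ![2, 1, 0], ![2, 0, 1], ![1, 2, 0], ![0, 2, 1],
        ![1, 0, 2], ![0, 1, 2], ![1, 1, 1]} := by decide
  conv_lhs => rw [hsum, hlist]
  repeat rw [Finset.sum_insert (by decide)]
  simp only [Finset.sum_singleton, Fin.prod_univ_three, Matrix.cons_val, pow_zero, pow_one,
    mul_one, one_mul]
  ring

theorem cubic_through_P3_forces_a
    {k : Type*} [Field k] [CharZero k] (a b c u v m : k)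
    (hgen : GeneralPosition
      ![p1 k, p2 k a, p3 k, p4 k b, p5 k, p6 k u, p7 k m v, p8 k m c])
    (h1 : u*v*m - u*m - v^2 - v*m + 2*v + m - 1 ≠ 0)
    (h2 : c*v - c*m - c + u - v*m - v + m^2 + 2*m - 1 ≠ 0)
    (hF : ∃ F : MvPolynomial (Fin 3) k, F ≠ 0 ∧ F.IsHomogeneous 3 ∧
      SingularAt F (p3 k) ∧ VanishesAt F (p1 k) ∧ VanishesAt F (p2 k a) ∧
      VanishesAt F (p5 k) ∧ VanishesAt F (p6 k u) ∧ VanishesAt F (p7 k m v) ∧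
      VanishesAt F (p8 k m c) ∧ VanishesAt F (q0 k)) :
    a * (c*v - c*m - c + u - v*m - v + m^2 + 2*m - 1) =
      c*u*v - c*u*m - 2*c*v + 2*c*m - u*v*m + u*m^2 + 2*v*m - 2*m^2 := by
  obtain ⟨F, hne, hhom, hsing, hv1, hv2, hv5, hv6, hv7, hv8, hq⟩ := hF
  obtain ⟨-, hcol, -, -⟩ := hgen
  have hm0 : m ≠ 0 := by
    rintro rfl
    refine not_linearIndependent_of_dotProduct_eq_zero (w := ![1, 0, 0]) (by simp) ?_ ?_ ?_
      (hcol 0 1 6 (by decide) (by decide) (by decide)) <;>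
    exact rep_mk_dotProduct_eq_zero _ (by simp)
  have hm1 : m ≠ 1 := by
    rintro rfl
    refine not_linearIndependent_of_dotProduct_eq_zero (w := ![1, -1, 0]) (by simp) ?_ ?_ ?_
      (hcol 4 5 6 (by decide) (by decide) (by decide)) <;>
    exact rep_mk_dotProduct_eq_zero _ (by simp)
  have ha1 : a - 1 ≠ 0 := by
    intro h
    obtain rfl := sub_eq_zero.mp h
    refine not_linearIndependent_of_dotProduct_eq_zero (w := ![1, 1, -1]) (by simp) ?_ ?_ ?_
      (hcol 0 1 2 (by decide) (by decide) (by decide)) <;>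
    exact rep_mk_dotProduct_eq_zero _ (by simp)
  have hu1 : u - 1 ≠ 0 := by
    intro h
    obtain rfl := sub_eq_zero.mp h
    refine not_linearIndependent_of_dotProduct_eq_zero (w := ![0, 1, -1]) (by simp) ?_ ?_ ?_
      (hcol 0 4 5 (by decide) (by decide) (by decide)) <;>
    exact rep_mk_dotProduct_eq_zero _ (by simp)
  have hcv : c - v ≠ 0 := by
    intro h
    obtain rfl := sub_eq_zero.mp h
    refine not_linearIndependent_of_dotProduct_eq_zero (w := ![c - 1, m, -m]) (by simp [hm0])
      ?_ ?_ ?_ (hcol 0 6 7 (by decide) (by decide) (by decide)) <;>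
    exact rep_mk_dotProduct_eq_zero _ (by simp; try ring)
  have e1 := (eval_rep_mk_eq_zero_iff hhom _ _).mp hv1
  have e2 := (eval_rep_mk_eq_zero_iff hhom _ _).mp hv2
  have e5 := (eval_rep_mk_eq_zero_iff hhom _ _).mp hv5
  have e6 := (eval_rep_mk_eq_zero_iff hhom _ _).mp hv6
  have e7 := (eval_rep_mk_eq_zero_iff hhom _ _).mp hv7
  have e8 := (eval_rep_mk_eq_zero_iff hhom _ _).mp hv8
  have eq := (eval_rep_mk_eq_zero_iff hhom _ _).mp hq
  have d0 := (eval_rep_mk_eq_zero_iff hhom.pderiv _ _).mp (hsing 0)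
  have d1 := (eval_rep_mk_eq_zero_iff hhom.pderiv _ _).mp (hsing 1)
  have d2 := (eval_rep_mk_eq_zero_iff hhom.pderiv _ _).mp (hsing 2)
  obtain ⟨f, rfl⟩ := exists_coeffs_of_isHomogeneous_three hhom
  simp [pderiv_X, Derivation.leibniz_pow] at e1 e2 e5 e6 e7 e8 eq d0 d1 d2
  generalize f ![3, 0, 0] = x3 at *
  generalize f ![0, 3, 0] = y3 at *
  generalize f ![0, 0, 3] = z3 at *
  generalize f ![2, 1, 0] = xxy at *
  generalize f ![2, 0, 1] = xxz at *
  generalize f ![1, 2, 0] = xyy at *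
  generalize f ![0, 2, 1] = yyz at *
  generalize f ![1, 0, 2] = s at *
  generalize f ![0, 1, 2] = r at *
  generalize f ![1, 1, 1] = xyz at *
  obtain rfl := eq
  obtain rfl : xxz = -2 * s := by linear_combination d2
  obtain rfl : s = x3 := by
    refine mul_right_cancel₀ (three_ne_zero : (3 : k) ≠ 0) ?_
    linear_combination -d0
  obtain rfl : yyz = -(1 + a) * r := by
    refine mul_left_cancel₀ ha1 ?_
    linear_combination e2 - e1
  obtain rfl : y3 = a * r := by linear_combination e1
  obtain rfl : xyz = (a - u) * r + (1 - u) * s := by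
    refine mul_left_cancel₀ hu1 ?_
    linear_combination e6 - e5
  obtain rfl : xxy = -(1 + a - u) * r - (1 - u) * s := by linear_combination d1
  obtain rfl : r = xyy := by linear_combination -e5
  have hA : r * (-(1 + a) + m * (a - u) + v + c)
      + s * (m * (1 - u - 2 * m + v + c)) = 0 := by
    refine (mul_eq_zero.mp ?_).resolve_left hcv
    linear_combination e8 - e7
  have hB : r * (a + m - m ^ 2 * (1 + a - u) - v * c)
      + s * (m * (-m + m * u + m ^ 2 - v * c)) = 0 := by
    linear_combination e7 - v * hA
  by_contra hgoal
  have hdet : m * (m - 1) * (a * (c*v - c*m - c + u - v*m - v + m^2 + 2*m - 1) -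
      (c*u*v - c*u*m - 2*c*v + 2*c*m - u*v*m + u*m^2 + 2*v*m - 2*m^2)) ≠ 0 :=
    mul_ne_zero (mul_ne_zero hm0 (sub_ne_zero.mpr hm1)) (sub_ne_zero.mpr hgoal)
  have hr : r = 0 := by
    refine (mul_eq_zero.mp ?_).resolve_left hdet
    linear_combination m * (1 - u - 2 * m + v + c) * hB - m * (-m + m * u + m ^ 2 - v * c) * hA
  have hs : s = 0 := by
    refine (mul_eq_zero.mp ?_).resolve_left hdet
    linear_combination (a + m - m ^ 2 * (1 + a - u) - v * c) * hA
      - (-(1 + a) + m * (a - u) + v + c) * hB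
  exact hne (by simp [hr, hs])

end
end

section
/- The eight points P1 = (0:1:1), P2 = (0:3861:1957), P3 = (1:0:1), P4 = (1188:0:−19), P5 = (1:1:1), P6 = (780:780:1883), P7 = (−52:52:51), P8 = (−9:9:−17) of ℙ²(ℚ) are in general position. -/
open MvPolynomial

noncomputable section

variable {k : Type*} [Field k]

lemma ne_zero_of_coord {k : Type*} [Field k] {x y z : k} (i : Fin 3)
    (h : ![x, y, z] i ≠ 0) : ![x, y, z] ≠ 0 :=
  fun h0 => h (by rw [h0]; rfl)

/-- Fraction-free Gaussian elimination on the rows of `M`, each of length `n`: returns `true` only if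
the homogeneous linear system with these rows has no nonzero solution. -/
def hasTrivialKernel : ℕ → List (List ℤ) → Bool
  | 0, _ => true
  | n + 1, M =>
    match M.find? (fun r => r.headI != 0) with
    | none => false
    | some p => hasTrivialKernel n (M.map fun r =>
        List.zipWith (fun a b => p.headI * a - r.headI * b) r.tail p.tail)

/-- The pairing of an integral row with a rational vector. -/
def rowDot (r : List ℤ) (x : List ℚ) : ℚ :=
  (List.zipWith (fun (a : ℤ) (t : ℚ) => (a : ℚ) * t) r x).sum

@[simp] lemma rowDot_nil (x : List ℚ) : rowDot [] x = 0 := by simp [rowDot]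

@[simp] lemma rowDot_cons (a : ℤ) (r : List ℤ) (t : ℚ) (x : List ℚ) :
    rowDot (a :: r) (t :: x) = a * t + rowDot r x := by simp [rowDot]

lemma rowDot_map {α : Type*} (L : List α) (f : α → ℤ) (g : α → ℚ) :
    rowDot (L.map f) (L.map g) = (L.map fun e => (f e : ℚ) * g e).sum := by
  induction L with
  | nil => simp
  | cons a L ih => simp [ih]

lemma rowDot_zipWith_sub (c d : ℤ) (r q : List ℤ) (x : List ℚ) (hr : r.length = x.length)
    (hq : q.length = x.length) :
    rowDot (List.zipWith (fun a b => c * a - d * b) r q) x = c * rowDot r x - d * rowDot q x := by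
  induction x generalizing r q with
  | nil => simp [List.eq_nil_of_length_eq_zero hr, List.eq_nil_of_length_eq_zero hq]
  | cons t x ih =>
    obtain ⟨a, r, rfl⟩ := List.exists_cons_of_length_eq_add_one hr
    obtain ⟨b, q, rfl⟩ := List.exists_cons_of_length_eq_add_one hq
    simp only [List.zipWith_cons_cons, rowDot_cons,
      ih r q (by simpa using hr) (by simpa using hq)]
    push_cast
    ring

lemma eq_zero_of_hasTrivialKernel (x : List ℚ) : ∀ M : List (List ℤ),
    (∀ r ∈ M, r.length = x.length) → hasTrivialKernel x.length M = true →
    (∀ r ∈ M, rowDot r x = 0) → ∀ t ∈ x, t = 0 := by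
  induction x with
  | nil => simp
  | cons t x ih =>
    intro M hlen hM hdot
    rw [List.length_cons, hasTrivialKernel] at hM
    split at hM
    · simp at hM
    · next p hp =>
      have hpM := List.mem_of_find?_eq_some hp
      have hp0 : p.headI ≠ 0 := by simpa using List.find?_some hp
      have key : ∀ r ∈ M, r.tail.length = x.length ∧ r.headI * t + rowDot r.tail x = 0 := by
        intro r hr
        have h1 := hlen r hr
        have h2 := hdot r hr
        cases r with
        | nil => simp at h1
        | cons a r => simpa using And.intro h1 h2
      obtain ⟨hpl, hpd⟩ := key p hpM
      have hx : ∀ u ∈ x, u = 0 := by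
        refine ih _ ?_ hM ?_
        · intro r hr
          obtain ⟨q, hq, rfl⟩ := List.mem_map.1 hr
          rw [List.length_zipWith, (key q hq).1, hpl, min_self]
        · intro r hr
          obtain ⟨q, hq, rfl⟩ := List.mem_map.1 hr
          obtain ⟨hql, hqd⟩ := key q hq
          rw [rowDot_zipWith_sub _ _ _ _ _ hql hpl]
          linear_combination (p.headI : ℚ) * hqd - (q.headI : ℚ) * hpd
      have hz : ∀ (r : List ℤ) (y : List ℚ), (∀ u ∈ y, u = 0) → rowDot r y = 0 := by
        intro r y hy
        induction r generalizing y with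
        | nil => simp
        | cons a r ihr =>
          cases y with
          | nil => simp [rowDot]
          | cons u y =>
            simp only [List.mem_cons, forall_eq_or_imp] at hy
            simp [hy.1, ihr y hy.2]
      rw [hz _ _ hx, add_zero] at hpd
      have ht : t = 0 := (mul_eq_zero.1 hpd).resolve_left (by exact_mod_cast hp0)
      simpa [ht] using hx

/-- The value at an integral vector of the monomial with exponent `e`. -/
def monomialValue (v : Fin 3 → ℤ) (e : Fin 3 → ℕ) : ℤ := v 0 ^ e 0 * v 1 ^ e 1 * v 2 ^ e 2

/-- The values at `v` of the monomials of degree `d`. -/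
def valueRow (d : ℕ) (v : Fin 3 → ℤ) : List ℤ :=
  (List.Nat.antidiagonalTuple 3 d).map (monomialValue v)

/-- The values at `v` of the `i`-th partial derivatives of the monomials of degree `d`. -/
def pderivRow (d : ℕ) (i : Fin 3) (v : Fin 3 → ℤ) : List ℤ :=
  (List.Nat.antidiagonalTuple 3 d).map fun e =>
    monomialValue v (fun j => if j = i then e j - 1 else e j) * e i

/-- The coefficients of `F` at the monomials of degree `d`. -/
def coeffList (d : ℕ) (F : MvPolynomial (Fin 3) ℚ) : List ℚ :=
  (List.Nat.antidiagonalTuple 3 d).map fun e => coeff (Finsupp.equivFunOnFinite.symm e) F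

lemma eq_sum_monomial {d : ℕ} {F : MvPolynomial (Fin 3) ℚ} (hF : F.IsHomogeneous d) :
    F = ((List.Nat.antidiagonalTuple 3 d).map fun e =>
      monomial (Finsupp.equivFunOnFinite.symm e)
        (coeff (Finsupp.equivFunOnFinite.symm e) F)).sum := by
  classical
  rw [← List.sum_toFinset _ (List.Nat.nodup_antidiagonalTuple 3 d)]
  conv_lhs => rw [F.as_sum]
  refine Eq.trans ?_ (Finset.sum_map (List.Nat.antidiagonalTuple 3 d).toFinset
    Finsupp.equivFunOnFinite.symm.toEmbedding (fun m => monomial m (coeff m F)))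
  refine Finset.sum_subset ?_ ?_
  · intro m hm
    refine Finset.mem_map.2 ⟨m, ?_, by ext; simp⟩
    have := hF (mem_support_iff.1 hm)
    rw [Finsupp.weight_apply, Finsupp.sum_fintype _ _ (by simp)] at this
    rw [List.mem_toFinset, List.Nat.mem_antidiagonalTuple]
    simpa using this
  · intro m _ hm
    simp [notMem_support_iff.1 hm]

lemma eval_monomial_intCast (v : Fin 3 → ℤ) (m : Fin 3 →₀ ℕ) (c : ℚ) :
    eval (fun j => (v j : ℚ)) (monomial m c) = monomialValue v m * c := by
  rw [eval_monomial, Finsupp.prod_fintype _ _ (by simp), Fin.prod_univ_three, monomialValue]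
  push_cast
  ring

lemma rowDot_valueRow {d : ℕ} {F : MvPolynomial (Fin 3) ℚ} (hF : F.IsHomogeneous d)
    (v : Fin 3 → ℤ) :
    rowDot (valueRow d v) (coeffList d F) = eval (fun j => (v j : ℚ)) F := by
  conv_rhs => rw [eq_sum_monomial hF]
  rw [valueRow, coeffList, rowDot_map, map_list_sum, List.map_map]
  congr 1
  refine List.map_congr_left fun e _ => ?_
  rw [Function.comp_apply, eval_monomial_intCast]
  rfl

lemma rowDot_pderivRow {d : ℕ} {F : MvPolynomial (Fin 3) ℚ} (hF : F.IsHomogeneous d)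
    (i : Fin 3) (v : Fin 3 → ℤ) :
    rowDot (pderivRow d i v) (coeffList d F) = eval (fun j => (v j : ℚ)) (pderiv i F) := by
  conv_rhs => rw [eq_sum_monomial hF]
  rw [pderivRow, coeffList, rowDot_map, map_list_sum, map_list_sum, List.map_map, List.map_map]
  congr 1
  refine List.map_congr_left fun e _ => ?_
  rw [Function.comp_apply, Function.comp_apply, pderiv_monomial, eval_monomial_intCast]
  have : (fun j => if j = i then e j - 1 else e j) =
      ⇑(Finsupp.equivFunOnFinite.symm e - Finsupp.single i 1 : Fin 3 →₀ ℕ) := by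
    ext j
    by_cases h : j = i
    · subst h; simp
    · simp [h]
  rw [this, Finsupp.equivFunOnFinite_symm_apply_apply]
  push_cast
  ring

lemma length_coeffList (d : ℕ) (F : MvPolynomial (Fin 3) ℚ) :
    (coeffList d F).length = (List.Nat.antidiagonalTuple 3 d).length := by
  rw [coeffList, List.length_map]

lemma eq_zero_of_rowDot_coeffList {d : ℕ} {F : MvPolynomial (Fin 3) ℚ} (hF : F.IsHomogeneous d)
    {M : List (List ℤ)} (hlen : ∀ r ∈ M, r.length = (List.Nat.antidiagonalTuple 3 d).length)
    (hM : hasTrivialKernel (List.Nat.antidiagonalTuple 3 d).length M = true)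
    (hdot : ∀ r ∈ M, rowDot r (coeffList d F) = 0) : F = 0 := by
  rw [← length_coeffList d F] at hM hlen
  have h := eq_zero_of_hasTrivialKernel _ M hlen hM hdot
  rw [eq_sum_monomial hF]
  refine List.sum_eq_zero fun q hq => ?_
  obtain ⟨e, he, rfl⟩ := List.mem_map.1 hq
  rw [h _ (List.mem_map.2 ⟨e, he, rfl⟩), map_zero]

lemma IsHomogeneous.eval_smul_eq {d : ℕ} {F : MvPolynomial (Fin 3) ℚ} (hF : F.IsHomogeneous d)
    (a : ℚ) (v : Fin 3 → ℚ) : eval (a • v) F = a ^ d * eval v F := by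
  rw [eval_eq, eval_eq, Finset.mul_sum]
  refine Finset.sum_congr rfl fun m hm => ?_
  have := hF (mem_support_iff.1 hm)
  rw [Finsupp.weight_apply, Finsupp.sum_fintype _ _ (by simp)] at this
  have h : ∏ i ∈ m.support, (a • v) i ^ m i = a ^ d * ∏ i ∈ m.support, v i ^ m i := by
    simp only [Pi.smul_apply, smul_eq_mul, mul_pow, Finset.prod_mul_distrib]
    rw [Finset.prod_pow_eq_pow_sum, ← this]
    congr 2
    refine Finset.sum_subset (Finset.subset_univ _) ?_ |>.trans (by simp)
    intro i _ hi
    simpa using hi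
  rw [h]
  ring

/-- A configuration with integral representatives is in general position as soon as the
linear systems expressing degeneracy have only the trivial solution. -/
lemma generalPosition_of_hasTrivialKernel (p : Fin 8 → P2 ℚ) (v : Fin 8 → Fin 3 → ℤ)
    (hp : ∀ i, ∃ a : ℚ, a ≠ 0 ∧ (p i).rep = a • fun j => (v i j : ℚ))
    (hline : ∀ i j l : Fin 8, i ≠ j → i ≠ l → j ≠ l →
      hasTrivialKernel 3 [[v i 0, v j 0, v l 0], [v i 1, v j 1, v l 1],
        [v i 2, v j 2, v l 2]] = true)
    (hconic : ∀ s : Finset (Fin 8), s.card = 6 →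
      hasTrivialKernel (List.Nat.antidiagonalTuple 3 2).length
        (((List.finRange 8).filter (· ∈ s)).map fun i => valueRow 2 (v i)) = true)
    (hcubic : ∀ i, hasTrivialKernel (List.Nat.antidiagonalTuple 3 3).length
      ((List.finRange 8).map (fun j => valueRow 3 (v j)) ++
        (List.finRange 3).map fun j => pderivRow 3 j (v i)) = true) :
    GeneralPosition p := by
  have heval : ∀ {d : ℕ} {F : MvPolynomial (Fin 3) ℚ}, F.IsHomogeneous d → ∀ i,
      eval (p i).rep F = 0 → eval (fun j => (v i j : ℚ)) F = 0 := by
    intro d F hF i h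
    obtain ⟨a, ha, hrep⟩ := hp i
    rw [hrep, IsHomogeneous.eval_smul_eq hF] at h
    exact (mul_eq_zero.1 h).resolve_left (pow_ne_zero _ ha)
  have hind : ∀ i j l : Fin 8, i ≠ j → i ≠ l → j ≠ l →
      LinearIndependent ℚ ![(p i).rep, (p j).rep, (p l).rep] := by
    intro i j l hij hil hjl
    rw [Fintype.linearIndependent_iff]
    intro g hg
    obtain ⟨a, ha, hai⟩ := hp i
    obtain ⟨b, hb, hbj⟩ := hp j
    obtain ⟨c, hc, hcl⟩ := hp l
    have hcoord : ∀ m : Fin 3, v i m * (g 0 * a) + (v j m * (g 1 * b) + v l m * (g 2 * c)) = 0 := by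
      intro m
      have := congrFun hg m
      simp only [Fin.sum_univ_three, hai, hbj, hcl, Matrix.cons_val_zero, Matrix.cons_val_one,
        Matrix.cons_val, Pi.add_apply, Pi.smul_apply, smul_eq_mul,
        Pi.zero_apply] at this
      linear_combination this
    have := eq_zero_of_hasTrivialKernel [g 0 * a, g 1 * b, g 2 * c] _ (by simp)
      (hline i j l hij hil hjl) (by simpa using ⟨hcoord 0, hcoord 1, hcoord 2⟩)
    simp only [List.mem_cons, List.not_mem_nil, or_false, forall_eq_or_imp, forall_eq,
      mul_eq_zero, ha, hb, hc] at this
    intro m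
    fin_cases m
    exacts [this.1, this.2.1, this.2.2]
  refine ⟨?_, hind, ?_, ?_⟩
  · intro i j hij
    by_contra hne
    obtain ⟨l, hil, hjl⟩ : ∃ l : Fin 8, i ≠ l ∧ j ≠ l := by
      clear hij hne
      revert i j
      decide
    have := (hind i j l hne hil hjl).injective (a₁ := 0) (a₂ := 1) (by simp [hij])
    simp at this
  · rintro ⟨F, hF0, hF, s, hs, hvan⟩
    refine hF0 (eq_zero_of_rowDot_coeffList hF ?_ (hconic s hs) ?_)
    · simp [valueRow]
    · intro r hr
      obtain ⟨i, hi, rfl⟩ := List.mem_map.1 hr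
      rw [rowDot_valueRow hF]
      exact heval hF i (hvan i (by simpa using hi))
  · rintro ⟨F, hF0, hF, hvan, i, hsing⟩
    refine hF0 (eq_zero_of_rowDot_coeffList hF ?_ (hcubic i) ?_)
    · intro r hr
      rcases List.mem_append.1 hr with hr | hr <;> obtain ⟨j, -, rfl⟩ := List.mem_map.1 hr
      · simp [valueRow]
      · simp [pderivRow]
    · intro r hr
      rcases List.mem_append.1 hr with hr | hr <;> obtain ⟨j, -, rfl⟩ := List.mem_map.1 hr
      · rw [rowDot_valueRow hF]
        exact heval hF j (hvan j)
      · rw [rowDot_pderivRow hF]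
        exact heval hF.pderiv i (hsing j)

/-- Integral homogeneous coordinates of the eight points. -/
def integralPoints : Fin 8 → Fin 3 → ℤ :=
  ![![0, 1, 1], ![0, 3861, 1957], ![1, 0, 1], ![1188, 0, -19], ![1, 1, 1], ![780, 780, 1883],
    ![-52, 52, 51], ![-9, 9, -17]]

lemma exists_rep_pt_eq (x y z : ℚ) (h : ![x, y, z] ≠ 0) (w : Fin 3 → ℤ)
    (hw : ![x, y, z] = fun j => (w j : ℚ)) :
    ∃ a : ℚ, a ≠ 0 ∧ (pt x y z h).rep = a • fun j => (w j : ℚ) := by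
  obtain ⟨a, ha⟩ := Projectivization.exists_smul_eq_mk_rep ℚ _ h
  exact ⟨a, a.ne_zero, by rw [pt, ← ha, hw, Units.smul_def]⟩

theorem example_points_general_position_Q' :
    GeneralPosition
    ![pt (0 : ℚ) 1 1 (ne_zero_of_coord 1 (by norm_num)),
      pt (0 : ℚ) 3861 1957 (ne_zero_of_coord 1 (by norm_num)),
      pt (1 : ℚ) 0 1 (ne_zero_of_coord 0 (by norm_num)),
      pt (1188 : ℚ) 0 (-19) (ne_zero_of_coord 0 (by norm_num)),
      pt (1 : ℚ) 1 1 (ne_zero_of_coord 0 (by norm_num)),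
      pt (780 : ℚ) 780 1883 (ne_zero_of_coord 0 (by norm_num)),
      pt (-52 : ℚ) 52 51 (ne_zero_of_coord 1 (by norm_num)),
      pt (-9 : ℚ) 9 (-17) (ne_zero_of_coord 1 (by norm_num))] := by
  refine generalPosition_of_hasTrivialKernel _ integralPoints ?_ ?_ ?_ ?_
  · intro i
    fin_cases i <;> refine exists_rep_pt_eq _ _ _ _ _ ?_ <;> ext j <;> fin_cases j <;>
      simp [integralPoints]
  · decide +kernel
  · decide +kernel
  · decide +kernel

end
end
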